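/- arXiv:2112.06491 — 4 statements merged into one kernel-verified Lean document; each statement's English description precedes it below -/
import Mathlib

section
/- Let F be a perfect field of characteristic p > 0 and let k = F((t)) be the field of Laurent series over F. Then the sequence 0 → k/k^p → Ω¹_k → Ω¹_k → 0 is exact, where the first map is induced by the universal derivation d : k → Ω¹_k (i.e. x ↦ dx, well-defined on k/k^p) and the second map is the Cartier operator C. -/
section helpers

open HahnSeries

/-- Pin the `F`-module structure on Laurent series to the one used by `Ω[k⁄F]`. -/
noncomputable local instance auxMod (F : Type) [Field F] : Module F (LaurentSeries F) :=
  Algebra.toModule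

theorem aux_coeff_pow_p (p : ℕ) [Fact p.Prime] (F : Type) [Field F] [CharP F p]
    (h : PowerSeries F) (n : ℕ) :
    PowerSeries.coeff n (h ^ p) = if p ∣ n then (PowerSeries.coeff (n / p) h) ^ p else 0 := by
  have hp : p ≠ 0 := (Fact.out : p.Prime).ne_zero
  have h1 : PowerSeries.map (frobenius F p) (PowerSeries.expand p hp h) = h ^ p :=
    MvPowerSeries.map_frobenius_expand p hp
  rw [← h1, PowerSeries.coeff_map, PowerSeries.coeff_expand]
  split_ifs with hd
  · simp [frobenius_def]
  · simp

theorem aux_decomp_ps (p : ℕ) [Fact p.Prime] (F : Type) [Field F] [CharP F p] [PerfectRing F p]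
    (f : PowerSeries F) : ∃ h : ℕ → PowerSeries F,
      f = ∑ i ∈ Finset.range p, h i ^ p * PowerSeries.X ^ i ∧
      ∀ i n, PowerSeries.coeff n (h i) ^ p = PowerSeries.coeff (p * n + i) f := by
  have hp : 0 < p := (Fact.out : p.Prime).pos
  let h : ℕ → PowerSeries F := fun i =>
    PowerSeries.mk fun n => (frobeniusEquiv F p).symm (PowerSeries.coeff (p * n + i) f)
  have hh : ∀ i n, PowerSeries.coeff n (h i) ^ p = PowerSeries.coeff (p * n + i) f := by
    intro i n
    simp only [h, PowerSeries.coeff_mk]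
    exact frobeniusEquiv_symm_pow_p F p _
  refine ⟨h, ?_, hh⟩
  ext n
  rw [map_sum, Finset.sum_eq_single (n % p)]
  · rw [PowerSeries.coeff_mul_X_pow', if_pos (Nat.mod_le n p), aux_coeff_pow_p,
      if_pos (Nat.dvd_sub_mod n), hh, Nat.mul_div_cancel' (Nat.dvd_sub_mod n),
      Nat.sub_add_cancel (Nat.mod_le n p)]
  · intro i hi hne
    rw [PowerSeries.coeff_mul_X_pow']
    split_ifs with hle
    · rw [aux_coeff_pow_p, if_neg]
      intro hd
      apply hne
      have := (Nat.modEq_iff_dvd' hle).2 hd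
      rw [← this, Nat.mod_eq_of_lt (Finset.mem_range.1 hi)]
    · rfl
  · intro hn
    exact absurd (Finset.mem_range.2 (Nat.mod_lt n hp)) hn

/-- The variable. -/
noncomputable def auxT (F : Type) [Field F] : LaurentSeries F := HahnSeries.single 1 1

theorem auxT_ne (F : Type) [Field F] : auxT F ≠ 0 := by
  simp [auxT]

theorem aux_shift (p : ℕ) [Fact p.Prime] (F : Type) [Field F] (x : LaurentSeries F) :
    ∃ (m : ℕ) (f : PowerSeries F),
      x = ((auxT F)⁻¹ ^ m) ^ p * (HahnSeries.ofPowerSeries ℤ F f) := by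
  have hp : 0 < p := (Fact.out : p.Prime).pos
  have h0 := LaurentSeries.single_order_mul_powerSeriesPart x
  have h1 : ∀ n : ℤ, (HahnSeries.single n 1 : LaurentSeries F) = auxT F ^ n := by
    intro n
    rw [auxT, ← RatFunc.single_zpow]
  obtain ⟨j, hj⟩ : ∃ j : ℕ, x.order + (x.order.natAbs * p : ℕ) = j := by
    apply Int.eq_ofNat_of_zero_le
    have : x.order.natAbs ≤ x.order.natAbs * p := Nat.le_mul_of_pos_right _ hp
    omega
  refine ⟨x.order.natAbs, PowerSeries.X ^ j * x.powerSeriesPart, ?_⟩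
  rw [map_mul, map_pow, HahnSeries.ofPowerSeries_X, ← auxT, ← mul_assoc]
  conv_lhs => rw [← h0]
  congr 1
  rw [h1, ← pow_mul, inv_pow, ← zpow_natCast, ← zpow_natCast, ← zpow_neg, ← zpow_add₀ (auxT_ne F),
    ← hj]
  congr 1
  ring

theorem aux_decomp (p : ℕ) [Fact p.Prime] (F : Type) [Field F] [CharP F p] [PerfectRing F p]
    (x : LaurentSeries F) : ∃ y : ℕ → LaurentSeries F,
      x = ∑ i ∈ Finset.range p, y i ^ p * auxT F ^ i := by
  obtain ⟨m, f, rfl⟩ := aux_shift p F x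
  obtain ⟨h, hf, -⟩ := aux_decomp_ps p F f
  refine ⟨fun i => (auxT F)⁻¹ ^ m * HahnSeries.ofPowerSeries ℤ F (h i), ?_⟩
  conv_lhs => rw [hf]
  rw [map_sum, Finset.mul_sum]
  refine Finset.sum_congr rfl fun i _ => ?_
  rw [map_mul, map_pow, map_pow, HahnSeries.ofPowerSeries_X, ← auxT]
  ring

/-- `t d/dt` on Laurent series, as a function. -/
noncomputable def auxThetaFun (F : Type) [Field F] (x : LaurentSeries F) : LaurentSeries F where
  coeff n := (n : F) * x.coeff n
  isPWO_support' := x.isPWO_support.mono (by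
    intro n hn hx
    apply hn
    simp only [hx, mul_zero])

theorem auxThetaFun_coeff (F : Type) [Field F] (x : LaurentSeries F) (n : ℤ) :
    (auxThetaFun F x).coeff n = (n : F) * x.coeff n := rfl

theorem auxTheta_supp (F : Type) [Field F] (x : LaurentSeries F) :
    (auxThetaFun F x).support ⊆ x.support := by
  intro n hn hx
  apply hn
  simp only [auxThetaFun_coeff, hx, mul_zero]

/-- `t d/dt` on Laurent series, as a derivation. -/
noncomputable def auxTheta (F : Type) [Field F] :
    Derivation F (LaurentSeries F) (LaurentSeries F) :=
  Derivation.mk'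
    { toFun := auxThetaFun F
      map_add' := by
        intro x y
        ext n
        simp [auxThetaFun_coeff, mul_add]
      map_smul' := by
        intro c x
        ext n
        rw [RingHom.id_apply, Algebra.smul_def, Algebra.smul_def]
        rw [HahnSeries.algebraMap_apply', PowerSeries.algebraMap_apply, HahnSeries.ofPowerSeries_C,
          auxThetaFun_coeff, HahnSeries.C_mul_eq_smul, HahnSeries.C_mul_eq_smul,
          HahnSeries.coeff_smul, HahnSeries.coeff_smul, auxThetaFun_coeff, smul_eq_mul,
          smul_eq_mul]
        ring }
    (by
      intro a b
      ext n
      simp only [LinearMap.coe_mk, AddHom.coe_mk, smul_eq_mul]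
      rw [mul_comm b, HahnSeries.coeff_add, auxThetaFun_coeff, HahnSeries.coeff_mul,
        HahnSeries.coeff_mul_right' b.isPWO_support (auxTheta_supp F b),
        HahnSeries.coeff_mul_left' a.isPWO_support (auxTheta_supp F a),
        ← Finset.sum_add_distrib, Finset.mul_sum]
      refine Finset.sum_congr rfl fun ij hij => ?_
      rw [Finset.mem_antidiagonal] at hij
      rw [auxThetaFun_coeff, auxThetaFun_coeff, ← hij.2.2]
      push_cast
      ring)

theorem auxTheta_coeff (F : Type) [Field F] (x : LaurentSeries F) (n : ℤ) :
    (auxTheta F x).coeff n = (n : F) * x.coeff n := rfl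

theorem auxTheta_T (F : Type) [Field F] : auxTheta F (auxT F) = auxT F := by
  ext n
  rw [auxTheta_coeff, auxT, HahnSeries.coeff_single]
  split_ifs with h <;> simp [h]

theorem aux_charP (p : ℕ) [Fact p.Prime] (F : Type) [Field F] [CharP F p] :
    CharP (LaurentSeries F) p :=
  charP_of_injective_algebraMap (algebraMap F (LaurentSeries F)).injective p

theorem aux_der_pow (p : ℕ) [Fact p.Prime] (F : Type) [Field F] [CharP F p]
    {M : Type} [AddCommGroup M] [Module F M] [Module (LaurentSeries F) M]
    (d : Derivation F (LaurentSeries F) M) (y : LaurentSeries F) : d (y ^ p) = 0 := by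
  have := aux_charP p F
  rw [Derivation.leibniz_pow, ← Nat.cast_smul_eq_nsmul (LaurentSeries F), CharP.cast_eq_zero,
    zero_smul]

theorem aux_theta_zero (p : ℕ) [Fact p.Prime] (F : Type) [Field F] [CharP F p] [PerfectRing F p]
    (x : LaurentSeries F) (hx : auxTheta F x = 0) : ∃ y, x = y ^ p := by
  have hp : 0 < p := (Fact.out : p.Prime).pos
  obtain ⟨m, f, rfl⟩ := aux_shift p F x
  obtain ⟨h, hf, hh⟩ := aux_decomp_ps p F f
  rw [Derivation.leibniz, aux_der_pow p, smul_zero, add_zero, smul_eq_mul, mul_eq_zero] at hx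
  have hx := hx.resolve_left (pow_ne_zero _ (pow_ne_zero _ (inv_ne_zero (auxT_ne F))))
  refine ⟨(auxT F)⁻¹ ^ m * HahnSeries.ofPowerSeries ℤ F (h 0), ?_⟩
  rw [mul_pow, ← map_pow]
  congr 2
  rw [hf, Finset.sum_eq_single 0]
  · simp
  · intro i hi hne
    have : h i = 0 := by
      ext n
      have h2 := congrArg (fun z => HahnSeries.coeff z ((p * n + i : ℕ) : ℤ)) hx
      simp only [auxTheta_coeff, HahnSeries.coeff_zero, HahnSeries.ofPowerSeries_apply_coeff] at h2
      rw [← hh i n] at h2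
      have hi0 : (i : F) ≠ 0 := by
        rw [Ne, CharP.cast_eq_zero_iff F p]
        intro hd
        exact absurd (Nat.le_of_dvd (Nat.pos_of_ne_zero hne) hd)
          (not_le.2 (Finset.mem_range.1 hi))
      have h3 := (mul_eq_zero.1 h2).resolve_left (by simpa using hi0)
      simpa using eq_zero_of_pow_eq_zero h3
    rw [this, zero_pow hp.ne', zero_mul]
  · intro hn
    exact absurd (Finset.mem_range.2 hp) hn

theorem aux_theta_D (F : Type) [Field F] (x : LaurentSeries F)
    (hx : KaehlerDifferential.D F (LaurentSeries F) x = 0) : auxTheta F x = 0 := by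
  rw [← Derivation.liftKaehlerDifferential_comp_D, hx, map_zero]

/-- `dt / t`. -/
noncomputable def auxW (F : Type) [Field F] : Ω[(LaurentSeries F)⁄F] :=
  (auxT F)⁻¹ • KaehlerDifferential.D F (LaurentSeries F) (auxT F)

theorem auxW_ne (F : Type) [Field F] : ∀ x : LaurentSeries F, x • auxW F = 0 → x = 0 := by
  intro x hx
  have h := congrArg (auxTheta F).liftKaehlerDifferential hx
  rw [auxW, map_smul, map_smul, Derivation.liftKaehlerDifferential_comp_D, auxTheta_T, map_zero,
    smul_eq_mul, smul_eq_mul, inv_mul_cancel₀ (auxT_ne F), mul_one] at h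
  exact h

theorem aux_D_T_pow (F : Type) [Field F] (i : ℕ) :
    KaehlerDifferential.D F (LaurentSeries F) (auxT F ^ i)
      = ((i : LaurentSeries F) * auxT F ^ i) • auxW F := by
  rw [Derivation.leibniz_pow, ← Nat.cast_smul_eq_nsmul (LaurentSeries F), auxW, smul_smul,
    smul_smul]
  congr 1
  rcases i with _ | i
  · rw [Nat.cast_zero, zero_mul, zero_mul]
  · rw [Nat.add_sub_cancel, pow_succ, mul_assoc, mul_assoc, mul_inv_cancel₀ (auxT_ne F), mul_one]

theorem aux_D_term (p : ℕ) [Fact p.Prime] (F : Type) [Field F] [CharP F p]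
    (y : LaurentSeries F) (i : ℕ) :
    KaehlerDifferential.D F (LaurentSeries F) (y ^ p * auxT F ^ i)
      = ((i : LaurentSeries F) * (y ^ p * auxT F ^ i)) • auxW F := by
  rw [Derivation.leibniz, aux_der_pow p, smul_zero, add_zero, aux_D_T_pow F i, smul_smul]
  congr 1
  ring

theorem aux_span (p : ℕ) [Fact p.Prime] (F : Type) [Field F] [CharP F p] [PerfectRing F p]
    (ω : Ω[(LaurentSeries F)⁄F]) : ∃ g : LaurentSeries F, ω = g • auxW F := by
  have hm : ω ∈ Submodule.span (LaurentSeries F) {auxW F} := by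
    have h1 : ω ∈ (⊤ : Submodule (LaurentSeries F) (Ω[(LaurentSeries F)⁄F])) := trivial
    rw [← KaehlerDifferential.span_range_derivation] at h1
    refine Submodule.span_le.2 ?_ h1
    rintro _ ⟨x, rfl⟩
    obtain ⟨y, rfl⟩ := aux_decomp p F x
    rw [map_sum]
    refine Submodule.sum_mem _ fun i _ => ?_
    rw [aux_D_term]
    exact Submodule.smul_mem _ _ (Submodule.mem_span_singleton_self _)
  obtain ⟨g, hg⟩ := Submodule.mem_span_singleton.1 hm
  exact ⟨g, hg.symm⟩

theorem aux_exact (p : ℕ) [Fact p.Prime] (F : Type) [Field F] [CharP F p] (y : LaurentSeries F)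
    (i : ℕ) (hi : i < p) (hne : i ≠ 0) :
    (y ^ p * auxT F ^ i) • auxW F = KaehlerDifferential.D F (LaurentSeries F)
      ((i : LaurentSeries F)⁻¹ * (y ^ p * auxT F ^ i)) := by
  have hi0 : (i : F) ≠ 0 := by
    rw [Ne, CharP.cast_eq_zero_iff F p]
    intro hd
    exact absurd (Nat.le_of_dvd (Nat.pos_of_ne_zero hne) hd) (not_le.2 hi)
  have hk : (i : LaurentSeries F) = algebraMap F (LaurentSeries F) (i : F) := by
    rw [map_natCast]
  have hk0 : (i : LaurentSeries F) ≠ 0 := by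
    rw [hk, Ne, map_eq_zero]
    exact hi0
  have hDi : KaehlerDifferential.D F (LaurentSeries F) (i : LaurentSeries F)⁻¹ = 0 := by
    rw [hk, ← map_inv₀, Derivation.map_algebraMap]
  rw [Derivation.leibniz, hDi, smul_zero, add_zero, aux_D_term p, smul_smul, ← mul_assoc,
    inv_mul_cancel₀ hk0, one_mul]

end helpers

theorem statement_0
    (p : ℕ) [Fact p.Prime] (F : Type) [Field F] [CharP F p] [PerfectRing F p]
    (C : Ω[(LaurentSeries F)⁄F] →+ Ω[(LaurentSeries F)⁄F])
    (hC_smul : ∀ (x : LaurentSeries F) (ω : Ω[(LaurentSeries F)⁄F]),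
      C (x ^ p • ω) = x • C ω)
    (hC_d : ∀ x : LaurentSeries F, C (KaehlerDifferential.D F (LaurentSeries F) x) = 0)
    (hC_log : ∀ x : LaurentSeries F,
      C (x ^ (p - 1) • KaehlerDifferential.D F (LaurentSeries F) x)
        = KaehlerDifferential.D F (LaurentSeries F) x) :
    (∀ x : LaurentSeries F,
        KaehlerDifferential.D F (LaurentSeries F) x = 0 ↔ ∃ y : LaurentSeries F, x = y ^ p)
      ∧ (∀ ω : Ω[(LaurentSeries F)⁄F],
          C ω = 0 ↔ ∃ x : LaurentSeries F, ω = KaehlerDifferential.D F (LaurentSeries F) x)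
      ∧ Function.Surjective C := by
  have hp : 0 < p := (Fact.out : p.Prime).pos
  have hW : C (auxW F) = auxW F := by
    have h1 : auxW F = (auxT F)⁻¹ ^ p •
        (auxT F ^ (p - 1) • KaehlerDifferential.D F (LaurentSeries F) (auxT F)) := by
      rw [auxW, smul_smul]
      congr 1
      obtain ⟨q, rfl⟩ : ∃ q, p = q + 1 := ⟨p - 1, by omega⟩
      rw [Nat.add_sub_cancel, pow_succ, mul_right_comm, ← mul_pow,
        inv_mul_cancel₀ (auxT_ne F), one_pow, one_mul]
    conv_lhs => rw [h1]
    rw [hC_smul, hC_log, auxW]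
  refine ⟨fun x => ⟨fun hx => ?_, ?_⟩, fun ω => ⟨fun hω => ?_, ?_⟩, fun ω => ?_⟩
  · apply aux_theta_zero p F x
    exact aux_theta_D F x hx
  · rintro ⟨y, rfl⟩
    exact aux_der_pow p F _ y
  · obtain ⟨g, rfl⟩ := aux_span p F ω
    obtain ⟨y, rfl⟩ := aux_decomp p F g
    have hsplit : (∑ i ∈ Finset.range p, y i ^ p * auxT F ^ i) • auxW F
        = KaehlerDifferential.D F (LaurentSeries F)
            (∑ i ∈ (Finset.range p).erase 0, (i : LaurentSeries F)⁻¹ * (y i ^ p * auxT F ^ i))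
          + y 0 ^ p • auxW F := by
      rw [← Finset.sum_erase_add _ _ (Finset.mem_range.2 hp), add_smul, pow_zero, mul_one,
        Finset.sum_smul, map_sum]
      congr 1
      refine Finset.sum_congr rfl fun i hi => ?_
      rw [Finset.mem_erase, Finset.mem_range] at hi
      exact aux_exact p F (y i) i hi.2 hi.1
    rw [hsplit] at hω ⊢
    rw [map_add, hC_d, zero_add, hC_smul, hW] at hω
    rw [auxW_ne F _ hω, zero_pow hp.ne', zero_smul, add_zero]
    exact ⟨_, rfl⟩
  · rintro ⟨x, rfl⟩
    exact hC_d x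
  · obtain ⟨g, rfl⟩ := aux_span p F ω
    exact ⟨g ^ p • auxW F, by rw [hC_smul, hW]⟩
end

section
/- Let F be a perfect field of characteristic p > 0 and k = F((t)). Then the sequence 0 → k×/(k×)^p → Ω¹_k → Ω¹_k → F/℘F → 0 is exact, where the first map is dlog (x ↦ dx/x), the second map is C − 1 (Cartier operator minus the identity), and the last map sends a differential ω to the class of its residue Res(ω) in F/℘F, where ℘(a) = a^p − a. -/
/-- The formal derivative of a Laurent series: `(∑ aₙ tⁿ)' = ∑ n aₙ tⁿ⁻¹`. -/
noncomputable def lseriesDeriv {R : Type} [CommRing R] (f : LaurentSeries R) :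
    LaurentSeries R where
  coeff n := (n + 1 : ℤ) • f.coeff (n + 1)
  isPWO_support' := by
    apply Set.IsPWO.mono (Set.IsPWO.image_of_monotone (f := fun m : ℤ => m - 1)
      f.isPWO_support (fun a b hab => by simpa using sub_le_sub_right hab 1))
    intro n hn
    rw [Function.mem_support] at hn
    refine ⟨n + 1, ?_, by ring⟩
    rw [HahnSeries.mem_support]
    intro h0
    exact hn (by simp [h0])

theorem exists_lseries {F : Type} [Field F] (f : ℤ → F) (N : ℤ) (h : ∀ n < N, f n = 0) :
    ∃ y : LaurentSeries F, ∀ n, y.coeff n = f n :=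
  ⟨HahnSeries.ofSuppBddBelow f ⟨N, fun n hn => by
    by_contra hlt
    exact hn (h n (not_le.1 hlt))⟩, fun _ => rfl⟩

theorem lseries_bdd {F : Type} [Field F] (y : LaurentSeries F) :
    ∃ N : ℤ, N ≤ 0 ∧ ∀ n < N, y.coeff n = 0 :=
  ⟨min 0 y.order, min_le_left _ _, fun n hn =>
    HahnSeries.coeff_eq_zero_of_lt_order (lt_of_lt_of_le hn (min_le_right _ _))⟩

theorem pseries_pow {p : ℕ} [hp : Fact p.Prime] {F : Type} [Field F] [CharP F p]
    (s : PowerSeries F) (n : ℕ) :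
    PowerSeries.coeff n (s ^ p) = if p ∣ n then (PowerSeries.coeff (n / p) s) ^ p else 0 := by
  have h : PowerSeries.map (frobenius F p) (PowerSeries.expand p hp.out.ne_zero s) = s ^ p :=
    MvPowerSeries.map_frobenius_expand p hp.out.ne_zero
  rw [← h, PowerSeries.coeff_map, PowerSeries.coeff_expand]
  split_ifs <;> simp [frobenius_def, hp.out.ne_zero]

theorem lseries_pow {p : ℕ} [hp : Fact p.Prime] {F : Type} [Field F] [CharP F p]
    (y : LaurentSeries F) (n : ℤ) :
    (y ^ p).coeff n = if (p : ℤ) ∣ n then (y.coeff (n / p)) ^ p else 0 := by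
  have hp0 : (p : ℤ) ≠ 0 := by exact_mod_cast hp.out.ne_zero
  have hpp : (0 : ℤ) < p := by exact_mod_cast hp.out.pos
  obtain ⟨m, s, rfl⟩ : ∃ (m : ℤ) (s : PowerSeries F),
      y = HahnSeries.single m 1 * HahnSeries.ofPowerSeries ℤ F s :=
    ⟨_, _, (LaurentSeries.single_order_mul_powerSeriesPart y).symm⟩
  rw [mul_pow, HahnSeries.single_pow, ← map_pow (HahnSeries.ofPowerSeries ℤ F), HahnSeries.coeff_single_mul,
    HahnSeries.coeff_single_mul, PowerSeries.coeff_coe, PowerSeries.coeff_coe]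
  have e : p • m = p * m := by simp
  rw [e, pseries_pow]
  simp only [one_pow, one_mul]
  by_cases hd : (p : ℤ) ∣ n
  · obtain ⟨k, rfl⟩ := hd
    rw [Int.mul_ediv_cancel_left _ hp0, if_pos (Dvd.intro _ rfl), ← mul_sub]
    by_cases hk : k - m < 0
    · rw [if_pos hk, if_pos (by nlinarith), zero_pow hp.out.ne_zero]
    · rw [if_neg hk, if_neg (by nlinarith), Int.natAbs_mul, Int.natAbs_natCast,
        if_pos (Dvd.intro _ rfl), Nat.mul_div_cancel_left _ hp.out.pos]
  · rw [if_neg hd]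
    have : ¬ (p ∣ (n - p * m).natAbs) := by
      rw [← Int.natCast_dvd]
      intro h
      exact hd ((dvd_sub_left (Dvd.intro _ rfl)).1 h)
    rw [if_neg this, ite_self]

/-- `t d/dt` determined by coefficients. -/
theorem exists_frac {p : ℕ} [hp : Fact p.Prime] {F : Type} [Field F] [CharP F p] [PerfectRing F p]
    (f : LaurentSeries F) (i : ℤ) :
    ∃ u : LaurentSeries F, ∀ n, u.coeff n ^ p = f.coeff (p * n + i) := by
  have hpp : (0 : ℤ) < p := by exact_mod_cast hp.out.pos
  obtain ⟨N, hN, h⟩ := lseries_bdd f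
  obtain ⟨u, hu⟩ := exists_lseries (fun n => (frobeniusEquiv F p).symm (f.coeff (p * n + i)))
    (N - |i|) (by
      intro n hn
      have h1 : |i| ≥ i := le_abs_self i
      have h2 : 0 ≤ |i| := abs_nonneg i
      have h3 : (1 : ℤ) ≤ p := hpp
      rw [h _ (by nlinarith), map_zero])
  refine ⟨u, fun n => ?_⟩
  rw [hu, frobeniusEquiv_symm_pow_p]

/-- decomposition over `p`-th powers -/
theorem exists_decomp {p : ℕ} [hp : Fact p.Prime] {F : Type} [Field F] [CharP F p] [PerfectRing F p]
    (f : LaurentSeries F) :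
    ∃ u : ℕ → LaurentSeries F,
      f = ∑ i ∈ Finset.range p, (u i) ^ p * (HahnSeries.single (1 : ℤ) (1 : F)) ^ i := by
  have hp0 : (p : ℤ) ≠ 0 := by exact_mod_cast hp.out.ne_zero
  have hpp : (0 : ℤ) < p := by exact_mod_cast hp.out.pos
  choose u hu using fun i : ℕ => exists_frac (p := p) f i
  refine ⟨u, ?_⟩
  ext n
  rw [HahnSeries.coeff_sum]
  have hr : ((n % p).toNat : ℤ) = n % p := Int.toNat_of_nonneg (Int.emod_nonneg _ hp0)
  have hlt := Int.emod_lt_of_pos n hpp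
  have hed := Int.mul_ediv_add_emod n p
  rw [Finset.sum_eq_single (n % p).toNat]
  · rw [HahnSeries.single_pow, HahnSeries.coeff_mul_single, lseries_pow]
    simp only [nsmul_eq_mul, mul_one, one_pow, hr]
    have : n - n % p = p * (n / p) := by linarith
    rw [this, if_pos (Dvd.intro _ rfl), Int.mul_ediv_cancel_left _ hp0, hu, hr, hed]
  · intro b hb hne
    rw [HahnSeries.single_pow, HahnSeries.coeff_mul_single, lseries_pow]
    simp only [nsmul_eq_mul, mul_one, one_pow]
    rw [if_neg]
    intro hd
    apply hne
    have h1 : n % p = (b : ℤ) % p :=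
      Int.emod_eq_emod_iff_emod_sub_eq_zero.2 (Int.emod_eq_zero_of_dvd hd)
    rw [Int.emod_eq_of_lt (a := (b : ℤ)) (Int.natCast_nonneg b) (by exact_mod_cast Finset.mem_range.1 hb)] at h1
    omega
  · intro h
    exact absurd (Finset.mem_range.2 (by omega)) h

theorem D_pow_char {p : ℕ} [hp : Fact p.Prime] {F : Type} [Field F] [CharP F p]
    (u : LaurentSeries F) :
    KaehlerDifferential.D F (LaurentSeries F) (u ^ p) = 0 := by
  rw [Derivation.leibniz_pow, ← Nat.cast_smul_eq_nsmul F, CharP.cast_eq_zero, zero_smul]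

theorem D_span {p : ℕ} [hp : Fact p.Prime] {F : Type} [Field F] [CharP F p] [PerfectRing F p]
    (f : LaurentSeries F) :
    ∃ h : LaurentSeries F, KaehlerDifferential.D F (LaurentSeries F) f =
      h • KaehlerDifferential.D F (LaurentSeries F) (HahnSeries.single (1 : ℤ) (1 : F)) := by
  obtain ⟨u, hu⟩ := exists_decomp (p := p) f
  refine ⟨∑ i ∈ Finset.range p, (u i) ^ p *
    ((i : LaurentSeries F) * (HahnSeries.single (1 : ℤ) (1 : F)) ^ (i - 1)), ?_⟩
  conv_lhs => rw [hu]
  rw [map_sum, Finset.sum_smul]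
  refine Finset.sum_congr rfl fun i _ => ?_
  rw [Derivation.leibniz, D_pow_char (u i), smul_zero, add_zero, Derivation.leibniz_pow,
    ← Nat.cast_smul_eq_nsmul (LaurentSeries F), mul_smul, mul_smul]

/-- the form `dt/t` -/
noncomputable def tauForm (F : Type) [Field F] : Ω[(LaurentSeries F)⁄F] :=
  (HahnSeries.single (-1 : ℤ) (1 : F) : LaurentSeries F) •
    KaehlerDifferential.D F (LaurentSeries F) (HahnSeries.single (1 : ℤ) (1 : F))

theorem single_mul_inv (F : Type) [Field F] :
    (HahnSeries.single (1 : ℤ) (1 : F) : LaurentSeries F) * HahnSeries.single (-1 : ℤ) (1 : F)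
      = 1 := by
  rw [HahnSeries.single_mul_single]; simp

theorem D_span' {p : ℕ} [hp : Fact p.Prime] {F : Type} [Field F] [CharP F p] [PerfectRing F p]
    (f : LaurentSeries F) :
    ∃ h : LaurentSeries F, KaehlerDifferential.D F (LaurentSeries F) f = h • tauForm F := by
  obtain ⟨h, hh⟩ := D_span (p := p) f
  refine ⟨h * HahnSeries.single (1 : ℤ) (1 : F), ?_⟩
  rw [hh, tauForm, smul_smul, mul_assoc, single_mul_inv, mul_one]

theorem exists_form {p : ℕ} [hp : Fact p.Prime] {F : Type} [Field F] [CharP F p] [PerfectRing F p]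
    (ω : Ω[(LaurentSeries F)⁄F]) : ∃ g : LaurentSeries F, ω = g • tauForm F := by
  have hω : ω ∈ Submodule.span (LaurentSeries F)
      (Set.range (KaehlerDifferential.D F (LaurentSeries F))) := by
    rw [KaehlerDifferential.span_range_derivation]; trivial
  induction hω using Submodule.span_induction with
  | mem x hx => obtain ⟨f, rfl⟩ := hx; exact D_span' (p := p) f
  | zero => exact ⟨0, by rw [zero_smul]⟩
  | add x y _ _ hx hy =>
    obtain ⟨a, rfl⟩ := hx; obtain ⟨b, rfl⟩ := hy; exact ⟨a + b, by rw [add_smul]⟩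
  | smul c x _ hx => obtain ⟨a, rfl⟩ := hx; exact ⟨c * a, by rw [mul_smul]⟩

theorem res_form {F : Type} [Field F] (Res : Ω[(LaurentSeries F)⁄F] →+ F)
    (hRes : ∀ f g : LaurentSeries F,
      Res (f • KaehlerDifferential.D F (LaurentSeries F) g) = (f * lseriesDeriv g).coeff (-1))
    (g : LaurentSeries F) : Res (g • tauForm F) = g.coeff 0 := by
  have h1 : lseriesDeriv (HahnSeries.single (1 : ℤ) (1 : F)) = 1 := by
    ext n
    simp only [lseriesDeriv, HahnSeries.coeff_single, HahnSeries.coeff_one]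
    by_cases h : n = 0 <;> simp [h]
  rw [tauForm, smul_smul, hRes, h1, mul_one, HahnSeries.coeff_mul_single]
  simp

theorem form_inj {F : Type} [Field F] (Res : Ω[(LaurentSeries F)⁄F] →+ F)
    (hRes : ∀ f g : LaurentSeries F,
      Res (f • KaehlerDifferential.D F (LaurentSeries F) g) = (f * lseriesDeriv g).coeff (-1))
    (f g : LaurentSeries F) (h : f • tauForm F = g • tauForm F) : f = g := by
  ext n
  have := congrArg (fun ω => Res ((HahnSeries.single (-n) (1 : F) : LaurentSeries F) • ω)) h
  simp only [smul_smul, res_form Res hRes, HahnSeries.coeff_single_mul] at this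
  simpa using this

theorem D_coeff {p : ℕ} [hp : Fact p.Prime] {F : Type} [Field F] [CharP F p] [PerfectRing F p]
    (Res : Ω[(LaurentSeries F)⁄F] →+ F)
    (hRes : ∀ f g : LaurentSeries F,
      Res (f • KaehlerDifferential.D F (LaurentSeries F) g) = (f * lseriesDeriv g).coeff (-1))
    (f : LaurentSeries F) : ∃ w : LaurentSeries F,
    KaehlerDifferential.D F (LaurentSeries F) f = w • tauForm F ∧
      ∀ n, w.coeff n = (n : F) * f.coeff n := by
  obtain ⟨w, hw⟩ := D_span' (p := p) f
  refine ⟨w, hw, fun n => ?_⟩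
  have := congrArg (fun ω => Res ((HahnSeries.single (-n) (1 : F) : LaurentSeries F) • ω)) hw
  simp only [smul_smul, res_form Res hRes, HahnSeries.coeff_single_mul, hRes, lseriesDeriv] at this
  simpa using this.symm

theorem D_eq_of_coeff {p : ℕ} [hp : Fact p.Prime] {F : Type} [Field F] [CharP F p]
    [PerfectRing F p] (Res : Ω[(LaurentSeries F)⁄F] →+ F)
    (hRes : ∀ f g : LaurentSeries F,
      Res (f • KaehlerDifferential.D F (LaurentSeries F) g) = (f * lseriesDeriv g).coeff (-1))
    (f w : LaurentSeries F) (h : ∀ n, w.coeff n = (n : F) * f.coeff n) :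
    KaehlerDifferential.D F (LaurentSeries F) f = w • tauForm F := by
  obtain ⟨w', h1, h2⟩ := D_coeff (p := p) Res hRes f
  have : w = w' := by ext n; rw [h, h2]
  rw [h1, this]

theorem C_tau {p : ℕ} [hp : Fact p.Prime] {F : Type} [Field F]
    (C : Ω[(LaurentSeries F)⁄F] →+ Ω[(LaurentSeries F)⁄F])
    (hC_smul : ∀ (x : LaurentSeries F) (ω : Ω[(LaurentSeries F)⁄F]),
      C (x ^ p • ω) = x • C ω)
    (hC_log : ∀ x : LaurentSeries F,
      C (x ^ (p - 1) • KaehlerDifferential.D F (LaurentSeries F) x)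
        = KaehlerDifferential.D F (LaurentSeries F) x)
    (x : LaurentSeries F) (hx : x ≠ 0) :
    C (x⁻¹ • KaehlerDifferential.D F (LaurentSeries F) x)
      = x⁻¹ • KaehlerDifferential.D F (LaurentSeries F) x := by
  have h : x⁻¹ = (x⁻¹) ^ p * x ^ (p - 1) := by
    obtain ⟨q, hq⟩ := Nat.exists_eq_succ_of_ne_zero hp.out.ne_zero
    rw [hq, Nat.succ_sub_one, pow_succ, mul_right_comm, ← mul_pow, inv_mul_cancel₀ hx, one_pow, one_mul]
  conv_lhs => rw [h, mul_smul, hC_smul, hC_log]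

theorem C_iff {p : ℕ} [hp : Fact p.Prime] {F : Type} [Field F] [CharP F p] [PerfectRing F p]
    (C : Ω[(LaurentSeries F)⁄F] →+ Ω[(LaurentSeries F)⁄F])
    (hC_smul : ∀ (x : LaurentSeries F) (ω : Ω[(LaurentSeries F)⁄F]),
      C (x ^ p • ω) = x • C ω)
    (hC_d : ∀ x : LaurentSeries F, C (KaehlerDifferential.D F (LaurentSeries F) x) = 0)
    (hC_log : ∀ x : LaurentSeries F,
      C (x ^ (p - 1) • KaehlerDifferential.D F (LaurentSeries F) x)
        = KaehlerDifferential.D F (LaurentSeries F) x)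
    (Res : Ω[(LaurentSeries F)⁄F] →+ F)
    (hRes : ∀ f g : LaurentSeries F,
      Res (f • KaehlerDifferential.D F (LaurentSeries F) g) = (f * lseriesDeriv g).coeff (-1))
    (g h : LaurentSeries F) :
    C (g • tauForm F) = h • tauForm F ↔ ∀ n : ℤ, h.coeff n ^ p = g.coeff (p * n) := by
  have hp0 : (p : ℤ) ≠ 0 := by exact_mod_cast hp.out.ne_zero
  have hτ : C (tauForm F) = tauForm F := by
    have hs : (HahnSeries.single (1 : ℤ) (1 : F) : LaurentSeries F) ≠ 0 := by simp
    have h := C_tau C hC_smul hC_log _ hs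
    rw [← eq_inv_of_mul_eq_one_right (single_mul_inv F)] at h
    exact h
  obtain ⟨u, hu⟩ := exists_frac (p := p) g 0
  simp only [add_zero] at hu
  have key : C (g • tauForm F) = u • tauForm F := by
    obtain ⟨N, -, hN⟩ := lseries_bdd (g - u ^ p)
    obtain ⟨w, hw⟩ := exists_lseries (fun n => (n : F)⁻¹ * (g - u ^ p).coeff n) N (by
      intro n hn; rw [hN n hn, mul_zero])
    have hD : KaehlerDifferential.D F (LaurentSeries F) w = (g - u ^ p) • tauForm F := by
      refine D_eq_of_coeff (p := p) Res hRes _ _ fun n => ?_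
      rw [hw]
      by_cases hn : (n : F) = 0
      · rw [hn, zero_mul]
        obtain ⟨k, rfl⟩ := (CharP.intCast_eq_zero_iff F p n).1 hn
        rw [HahnSeries.coeff_sub, lseries_pow, if_pos (Dvd.intro _ rfl),
          Int.mul_ediv_cancel_left _ hp0, hu, sub_self]
      · rw [mul_inv_cancel_left₀ hn]
    have : g • tauForm F = u ^ p • tauForm F + KaehlerDifferential.D F (LaurentSeries F) w := by
      rw [hD, ← add_smul]; congr 1; ring
    rw [this, map_add, hC_smul, hC_d, hτ, add_zero]
  rw [key]
  constructor
  · intro e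
    rw [← form_inj Res hRes _ _ e]
    exact hu
  · intro e
    congr 1
    ext n
    apply frobenius_inj F p
    simp only [frobenius_def]
    rw [hu, e]

theorem neg_coeff_zero {p : ℕ} [hp : Fact p.Prime] {F : Type} [Field F]
    (g : LaurentSeries F) (hg : ∀ n : ℤ, g.coeff n ^ p = g.coeff (p * n)) (n : ℤ) (hn : n < 0) :
    g.coeff n = 0 := by
  obtain ⟨N, hN0, hN⟩ := lseries_bdd g
  have h : ∀ k : ℕ, g.coeff (p ^ k * n) = g.coeff n ^ p ^ k := by
    intro k
    induction k with
    | zero => simp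
    | succ k ih => rw [pow_succ p k, pow_mul, ← ih, hg]; congr 1; ring
  have h2 : (N.natAbs : ℤ) < (p : ℤ) ^ N.natAbs := by exact_mod_cast Nat.lt_pow_self hp.out.one_lt
  have h3 := h N.natAbs
  rw [hN _ (by
    have : (N.natAbs : ℤ) = -N := by omega
    nlinarith)] at h3
  exact pow_eq_zero_iff (pow_ne_zero _ hp.out.ne_zero) |>.1 h3.symm

/-- Coefficients of the solution of `t x' = G x`. -/
noncomputable def solA {F : Type} [Field F] (p : ℕ) (G : ℕ → F) : ℕ → F
  | 0 => 1
  | (n + 1) => if p ∣ n + 1 then 0 else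
      ((n + 1 : ℕ) : F)⁻¹ * ∑ j : Fin (n + 1), solA p G j.1 * G (n + 1 - j.1)
  decreasing_by exact j.2

theorem exists_dlog_pos {p : ℕ} [hp : Fact p.Prime] {F : Type} [Field F] [CharP F p]
    [PerfectRing F p]
    (C : Ω[(LaurentSeries F)⁄F] →+ Ω[(LaurentSeries F)⁄F])
    (hC_smul : ∀ (x : LaurentSeries F) (ω : Ω[(LaurentSeries F)⁄F]),
      C (x ^ p • ω) = x • C ω)
    (hC_d : ∀ x : LaurentSeries F, C (KaehlerDifferential.D F (LaurentSeries F) x) = 0)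
    (hC_log : ∀ x : LaurentSeries F,
      C (x ^ (p - 1) • KaehlerDifferential.D F (LaurentSeries F) x)
        = KaehlerDifferential.D F (LaurentSeries F) x)
    (Res : Ω[(LaurentSeries F)⁄F] →+ F)
    (hRes : ∀ f g : LaurentSeries F,
      Res (f • KaehlerDifferential.D F (LaurentSeries F) g) = (f * lseriesDeriv g).coeff (-1))
    (G : PowerSeries F) (hG0 : PowerSeries.coeff 0 G = 0)
    (hG : ∀ n, PowerSeries.coeff n G ^ p = PowerSeries.coeff (p * n) G) :
    ∃ x : LaurentSeries F, x ≠ 0 ∧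
      KaehlerDifferential.D F (LaurentSeries F) x =
        (x * HahnSeries.ofPowerSeries ℤ F G) • tauForm F := by
  set P : PowerSeries F := PowerSeries.mk (solA p (fun n => PowerSeries.coeff n G)) with hP
  set W : PowerSeries F := PowerSeries.mk (fun n => (n : F) * PowerSeries.coeff n P) with hW
  have hP0 : PowerSeries.coeff 0 P = 1 := by simp [hP, solA]
  have hPinv : P * P⁻¹ = 1 := PowerSeries.mul_inv_cancel _ (by
    rw [← PowerSeries.coeff_zero_eq_constantCoeff_apply, hP0]; exact one_ne_zero)
  have hrec : ∀ n, ¬ p ∣ n → PowerSeries.coeff n W = PowerSeries.coeff n (P * G) := by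
    intro n hn
    obtain _ | n := n
    · exact absurd (dvd_zero p) hn
    have hne : ((n + 1 : ℕ) : F) ≠ 0 := fun h => hn ((CharP.cast_eq_zero_iff F p _).1 h)
    rw [PowerSeries.coeff_mul, Finset.Nat.sum_antidiagonal_eq_sum_range_succ
      (fun i j => PowerSeries.coeff i P * PowerSeries.coeff j G), Finset.sum_range_succ,
      Nat.sub_self, hG0, mul_zero, add_zero, hW, PowerSeries.coeff_mk]
    conv_lhs => rw [hP, PowerSeries.coeff_mk, solA, if_neg hn, mul_inv_cancel_left₀ hne]
    rw [Fin.sum_univ_eq_sum_range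
      (fun j => solA p (fun n => PowerSeries.coeff n G) j * PowerSeries.coeff (n + 1 - j) G)]
    simp [hP]
  set x : LaurentSeries F := HahnSeries.ofPowerSeries ℤ F P with hx
  have hxinv : x * HahnSeries.ofPowerSeries ℤ F P⁻¹ = 1 := by
    rw [hx, ← map_mul, hPinv, map_one]
  have hx0 : x ≠ 0 := left_ne_zero_of_mul_eq_one hxinv
  have hxi : x⁻¹ = HahnSeries.ofPowerSeries ℤ F P⁻¹ := (eq_inv_of_mul_eq_one_right hxinv).symm
  have hD : KaehlerDifferential.D F (LaurentSeries F) x =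
      HahnSeries.ofPowerSeries ℤ F W • tauForm F := by
    refine D_eq_of_coeff (p := p) Res hRes _ _ fun n => ?_
    rw [hx, PowerSeries.coeff_coe, PowerSeries.coeff_coe]
    split_ifs with h
    · rw [mul_zero]
    · rw [hW, PowerSeries.coeff_mk]
      congr 1
      rw [← Int.cast_natCast, Int.natAbs_of_nonneg (not_lt.1 h)]
  set Q : PowerSeries F := P⁻¹ * W with hQ
  have hQp : ∀ n, PowerSeries.coeff n Q ^ p = PowerSeries.coeff (p * n) Q := by
    intro n
    have h := C_tau C hC_smul hC_log x hx0
    rw [hD, smul_smul, hxi, ← map_mul,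
      C_iff C hC_smul hC_d hC_log Res hRes] at h
    have h' := h n
    rw [← Nat.cast_mul, LaurentSeries.coeff_coe_powerSeries,
      LaurentSeries.coeff_coe_powerSeries] at h'
    exact h'
  set H : PowerSeries F := Q - G with hH
  have hHp : ∀ n, PowerSeries.coeff (p * n) H = PowerSeries.coeff n H ^ p := by
    intro n
    rw [hH, map_sub, map_sub, sub_pow_char, hQp, hG]
  have hPH : P * H = W - P * G := by
    rw [hH, mul_sub, hQ, ← mul_assoc, hPinv, one_mul]
  have hH0 : ∀ n, PowerSeries.coeff n H = 0 := by
    intro n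
    induction n using Nat.strong_induction_on with
    | _ n ih =>
      have hcoef : PowerSeries.coeff n (P * H) = PowerSeries.coeff n H := by
        rw [PowerSeries.coeff_mul, Finset.sum_eq_single (0, n)]
        · rw [hP0, one_mul]
        · rintro ⟨i, j⟩ hij hne
          rw [Finset.HasAntidiagonal.mem_antidiagonal] at hij
          simp only at hij
          have : j < n := by
            rcases Nat.eq_zero_or_pos i with h | h
            · subst h; exact absurd (by simp [← hij]) hne
            · omega
          rw [ih j this, mul_zero]
        · intro h; simp at h
      by_cases hd : p ∣ n
      · obtain ⟨m, rfl⟩ := hd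
        rcases Nat.eq_zero_or_pos m with h | h
        · subst h
          rw [mul_zero] at hcoef ⊢
          rw [← hcoef, hPH, map_sub, PowerSeries.coeff_mul]
          simp [hW, hG0, -PowerSeries.coeff_zero_eq_constantCoeff]
        · rw [hHp, ih m (by nlinarith [hp.out.two_le]), zero_pow hp.out.ne_zero]
      · rw [← hcoef, hPH, map_sub, hrec n hd, sub_self]
  refine ⟨x, hx0, ?_⟩
  have hW' : W = P * G := by
    have : H = 0 := by ext n; rw [hH0, map_zero]
    rw [this, mul_zero] at hPH
    exact sub_eq_zero.1 hPH.symm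
  rw [hD, hW', map_mul]

theorem exists_intCast {p : ℕ} [hp : Fact p.Prime] {F : Type} [Field F] [CharP F p]
    (a : F) (ha : a ^ p = a) : ∃ k : ℤ, (k : F) = a := by
  exact (_root_.mem_bot_iff_intCast p F).1 ((Subfield.mem_bot_iff_pow_eq_self F p).2 ha)

theorem exists_dlog {p : ℕ} [hp : Fact p.Prime] {F : Type} [Field F] [CharP F p]
    [PerfectRing F p]
    (C : Ω[(LaurentSeries F)⁄F] →+ Ω[(LaurentSeries F)⁄F])
    (hC_smul : ∀ (x : LaurentSeries F) (ω : Ω[(LaurentSeries F)⁄F]),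
      C (x ^ p • ω) = x • C ω)
    (hC_d : ∀ x : LaurentSeries F, C (KaehlerDifferential.D F (LaurentSeries F) x) = 0)
    (hC_log : ∀ x : LaurentSeries F,
      C (x ^ (p - 1) • KaehlerDifferential.D F (LaurentSeries F) x)
        = KaehlerDifferential.D F (LaurentSeries F) x)
    (Res : Ω[(LaurentSeries F)⁄F] →+ F)
    (hRes : ∀ f g : LaurentSeries F,
      Res (f • KaehlerDifferential.D F (LaurentSeries F) g) = (f * lseriesDeriv g).coeff (-1))
    (g : LaurentSeries F) (hg : ∀ n : ℤ, g.coeff n ^ p = g.coeff (p * n)) :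
    ∃ x : LaurentSeries F, x ≠ 0 ∧
      KaehlerDifferential.D F (LaurentSeries F) x = (x * g) • tauForm F := by
  have hneg := neg_coeff_zero (p := p) g hg
  obtain ⟨k, hk⟩ := exists_intCast (p := p) (g.coeff 0) (by simpa using hg 0)
  set G : PowerSeries F := PowerSeries.mk (fun n => if n = 0 then 0 else g.coeff n) with hGdef
  have hgG : g = HahnSeries.single 0 (k : F) + HahnSeries.ofPowerSeries ℤ F G := by
    ext n
    rw [HahnSeries.coeff_add, PowerSeries.coeff_coe, HahnSeries.coeff_single, hGdef,
      PowerSeries.coeff_mk]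
    rcases lt_trichotomy n 0 with h | h | h
    · rw [if_neg h.ne, if_pos h, hneg n h, add_zero]
    · subst h; simp [hk]
    · rw [if_neg h.ne', if_neg h.not_gt, if_neg (by omega), Int.natAbs_of_nonneg h.le, zero_add]
  obtain ⟨y, hy0, hy⟩ := exists_dlog_pos C hC_smul hC_d hC_log Res hRes G
    (by rw [hGdef, PowerSeries.coeff_mk, if_pos rfl]) (by
      intro n
      rw [hGdef, PowerSeries.coeff_mk, PowerSeries.coeff_mk]
      by_cases hn : n = 0
      · subst hn; simp [hp.out.ne_zero]
      · rw [if_neg hn, if_neg (mul_ne_zero hp.out.ne_zero hn), hg, Nat.cast_mul])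
  have ht : KaehlerDifferential.D F (LaurentSeries F) (HahnSeries.single k (1 : F)) =
      (HahnSeries.single k (1 : F) * HahnSeries.single (0 : ℤ) (k : F) : LaurentSeries F) •
        tauForm F := by
    refine D_eq_of_coeff (p := p) Res hRes _ _ fun n => ?_
    rw [HahnSeries.coeff_mul_single_zero, HahnSeries.coeff_single]
    by_cases h : n = k
    · subst h; simp
    · simp [h]
  refine ⟨HahnSeries.single k (1 : F) * y, mul_ne_zero (by simp) hy0, ?_⟩
  rw [Derivation.leibniz, hy, ht, smul_smul, smul_smul, ← add_smul]
  congr 1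
  rw [hgG]
  ring

/-- positive part of the solution of `C h - h = g` -/
noncomputable def solB {F : Type} [Field F] (p : ℕ) (g : ℤ → F) (n : ℕ) : F :=
  if h : 0 < n ∧ 1 < p ∧ p ∣ n then (g ((n / p : ℕ) : ℤ) + solB p g (n / p)) ^ p else 0
  termination_by n
  decreasing_by exact Nat.div_lt_self h.1 h.2.1

theorem exists_AS {p : ℕ} [hp : Fact p.Prime] {F : Type} [Field F] [CharP F p]
    [PerfectRing F p] (g : LaurentSeries F) (a : F) (ha : g.coeff 0 = a ^ p - a) :
    ∃ h : LaurentSeries F, ∀ n : ℤ, (g + h).coeff n ^ p = h.coeff (p * n) := by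
  have hpp : (0 : ℤ) < p := by exact_mod_cast hp.out.pos
  obtain ⟨N, hN0, hN⟩ := lseries_bdd g
  set σ := (frobeniusEquiv F p).symm with hσ
  have hσi : ∀ (k : ℕ) (x : F), (σ^[k+1] x) ^ p = σ^[k] x := by
    intro k x
    rw [Function.iterate_succ_apply', hσ, frobeniusEquiv_symm_pow_p]
  have hσ0 : ∀ k : ℕ, σ^[k] 0 = 0 := fun k => Function.iterate_fixed (map_zero σ) k
  set S : ℤ → F := fun n => - ∑ k ∈ Finset.range (N.natAbs + 1), σ^[k] (g.coeff (p ^ k * n))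
    with hS
  have h1 : ∀ k : ℕ, (1 : ℤ) ≤ (p : ℤ) ^ k := fun k => one_le_pow₀ (by omega)
  obtain ⟨h, hh⟩ := exists_lseries (fun n : ℤ => if n = 0 then - a ^ p else
    if 0 < n then solB p g.coeff n.natAbs else S n) N (by
      intro n hn
      rw [if_neg (by omega), if_neg (by omega)]
      simp only [hS]
      rw [Finset.sum_eq_zero, neg_zero]
      intro k _
      rw [hN _ (by nlinarith [h1 k]), hσ0])
  refine ⟨h, fun n => ?_⟩
  rw [HahnSeries.coeff_add, hh, hh]
  rcases lt_trichotomy n 0 with hn | hn | hn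
  · have hpn : p * n < 0 := by nlinarith
    rw [if_neg hn.ne, if_neg hn.not_gt, if_neg hpn.ne, if_neg hpn.not_gt]
    have e1 : g.coeff n + S n = - ∑ k ∈ Finset.range (N.natAbs + 1),
        σ^[k+1] (g.coeff (p ^ (k + 1) * n)) := by
      have h2 := Finset.sum_range_succ (fun k => σ^[k] (g.coeff (p ^ k * n))) (N.natAbs + 1)
      rw [Finset.sum_range_succ'] at h2
      have h3 : g.coeff (p ^ (N.natAbs + 1) * n) = 0 := by
        apply hN
        have h4 : ((N.natAbs + 1 : ℕ) : ℤ) < (p : ℤ) ^ (N.natAbs + 1) := by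
          exact_mod_cast Nat.lt_pow_self hp.out.one_lt
        have h5 : ((N.natAbs + 1 : ℕ) : ℤ) = -N + 1 := by omega
        nlinarith
      rw [h3, hσ0, add_zero] at h2
      simp only [hS]
      rw [← h2]
      simp
    rw [e1]
    simp only [hS]
    rw [← frobenius_def, map_neg, map_sum]
    congr 1
    refine Finset.sum_congr rfl fun k _ => ?_
    rw [frobenius_def, hσi, pow_succ, mul_assoc]
  · subst hn
    rw [mul_zero, if_pos rfl, ha]
    have : a ^ p - a + -a ^ p = -a := by ring
    rw [this, ← frobenius_def, map_neg, frobenius_def]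
  · have hpn : 0 < p * n := by positivity
    rw [if_neg hn.ne', if_pos hn, if_neg hpn.ne', if_pos hpn]
    obtain ⟨m, rfl⟩ := Int.eq_ofNat_of_zero_le hn.le
    rw [← Nat.cast_mul, Int.natAbs_natCast, Int.natAbs_natCast]
    conv_rhs => rw [solB]
    rw [dif_pos ⟨by exact_mod_cast hpn, hp.out.one_lt, Dvd.intro _ rfl⟩,
      Nat.mul_div_cancel_left _ hp.out.pos]

/-!
STATEMENT 1: For a perfect field `F` of characteristic `p > 0` and `k = F((t))`, the sequence
`0 → k×/(k×)ᵖ → Ω¹_k → Ω¹_k → F/℘F → 0` is exact, where the maps are `dlog`, `C - 1` and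
`ω ↦ Res ω mod ℘F`.  Here `C` is the Cartier operator and `Res` is the residue map,
characterized by `Res (f • dg) = coeff₋₁ (f · g')`.

Exactness is expressed by: `ker dlog = (k×)ᵖ`, `ker (C - 1) = im dlog`,
`ker (Res mod ℘F) = im (C - 1)`, and surjectivity onto `F/℘F`.
-/
theorem statement_1
    (p : ℕ) [Fact p.Prime] (F : Type) [Field F] [CharP F p] [PerfectRing F p]
    (C : Ω[(LaurentSeries F)⁄F] →+ Ω[(LaurentSeries F)⁄F])
    (hC_smul : ∀ (x : LaurentSeries F) (ω : Ω[(LaurentSeries F)⁄F]),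
      C (x ^ p • ω) = x • C ω)
    (hC_d : ∀ x : LaurentSeries F, C (KaehlerDifferential.D F (LaurentSeries F) x) = 0)
    (hC_log : ∀ x : LaurentSeries F,
      C (x ^ (p - 1) • KaehlerDifferential.D F (LaurentSeries F) x)
        = KaehlerDifferential.D F (LaurentSeries F) x)
    (Res : Ω[(LaurentSeries F)⁄F] →+ F)
    (hRes : ∀ f g : LaurentSeries F,
      Res (f • KaehlerDifferential.D F (LaurentSeries F) g) = (f * lseriesDeriv g).coeff (-1)) :
    (∀ x : (LaurentSeries F)ˣ,
        ((x : LaurentSeries F)⁻¹ • KaehlerDifferential.D F (LaurentSeries F) (x : LaurentSeries F)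
            = 0)
          ↔ ∃ y : (LaurentSeries F)ˣ, (x : LaurentSeries F) = (y : LaurentSeries F) ^ p)
      ∧ (∀ ω : Ω[(LaurentSeries F)⁄F],
          C ω = ω ↔ ∃ x : (LaurentSeries F)ˣ,
            ω = (x : LaurentSeries F)⁻¹ •
              KaehlerDifferential.D F (LaurentSeries F) (x : LaurentSeries F))
      ∧ (∀ ω : Ω[(LaurentSeries F)⁄F],
          (∃ a : F, Res ω = a ^ p - a) ↔ ∃ η : Ω[(LaurentSeries F)⁄F], ω = C η - η)
      ∧ (∀ a : F, ∃ (ω : Ω[(LaurentSeries F)⁄F]) (b : F), Res ω = a + (b ^ p - b)) := by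
  have hp := Fact.out (p := p.Prime)
  have hp0 : (p : ℤ) ≠ 0 := by exact_mod_cast hp.ne_zero
  have hCi := C_iff C hC_smul hC_d hC_log Res hRes
  refine ⟨?_, ?_, ?_, ?_⟩
  · intro x
    constructor
    · intro h
      have hD : KaehlerDifferential.D F (LaurentSeries F) (x : LaurentSeries F) = 0 := by
        have h' := congrArg (fun ω => (x : LaurentSeries F) • ω) h
        simp only [smul_smul, smul_zero] at h'
        rwa [mul_inv_cancel₀ x.ne_zero, one_smul] at h'
      obtain ⟨w, hw, hwc⟩ := D_coeff (p := p) Res hRes (x : LaurentSeries F)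
      have hw0 : w = 0 := form_inj Res hRes _ _ (by rw [← hw, hD, zero_smul])
      obtain ⟨u, hu⟩ := exists_frac (p := p) (x : LaurentSeries F) 0
      simp only [add_zero] at hu
      have hxu : (x : LaurentSeries F) = u ^ p := by
        ext n
        rw [lseries_pow]
        split_ifs with hd
        · obtain ⟨k, rfl⟩ := hd
          rw [Int.mul_ediv_cancel_left _ hp0, hu]
        · have := hwc n
          rw [hw0, HahnSeries.coeff_zero] at this
          exact (mul_eq_zero.1 this.symm).resolve_left
            (fun h0 => hd ((CharP.intCast_eq_zero_iff F p n).1 h0))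
      have hu0 : u ≠ 0 := by
        rintro rfl
        rw [zero_pow hp.ne_zero] at hxu
        exact x.ne_zero hxu
      exact ⟨Units.mk0 u hu0, hxu⟩
    · rintro ⟨y, hy⟩
      rw [hy, D_pow_char, smul_zero]
  · intro ω
    constructor
    · intro h
      obtain ⟨g, rfl⟩ := exists_form (p := p) ω
      rw [hCi] at h
      obtain ⟨x, hx0, hx⟩ := exists_dlog C hC_smul hC_d hC_log Res hRes g h
      refine ⟨Units.mk0 x hx0, ?_⟩
      rw [Units.val_mk0, hx, smul_smul, inv_mul_cancel_left₀ hx0]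
    · rintro ⟨x, rfl⟩
      exact C_tau C hC_smul hC_log _ x.ne_zero
  · intro ω
    constructor
    · rintro ⟨a, ha⟩
      obtain ⟨g, rfl⟩ := exists_form (p := p) ω
      rw [res_form Res hRes] at ha
      obtain ⟨h, hh⟩ := exists_AS g a ha
      refine ⟨h • tauForm F, ?_⟩
      rw [(hCi h (g + h)).2 hh, add_smul, add_sub_cancel_right]
    · rintro ⟨η, rfl⟩
      obtain ⟨h, rfl⟩ := exists_form (p := p) η
      obtain ⟨u, hu⟩ := exists_form (p := p) (C (h • tauForm F))
      have h0 := (hCi h u).1 hu 0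
      rw [mul_zero] at h0
      refine ⟨-u.coeff 0, ?_⟩
      rw [map_sub, hu, res_form Res hRes, res_form Res hRes, ← h0, ← frobenius_def p (-u.coeff 0),
        map_neg, frobenius_def]
      ring
  · intro a
    refine ⟨(HahnSeries.single (0 : ℤ) a : LaurentSeries F) • tauForm F, 0, ?_⟩
    rw [res_form Res hRes, HahnSeries.coeff_single_same, zero_pow hp.ne_zero]
    ring
end

section
/- Let F be an algebraically closed field of characteristic p ≥ 0. Then the Brauer group of the Laurent series field F((t)) is trivial: Br(F((t))) = 0. -/
open Polynomial WithZero

lemma key_integral (F : Type) [Field F] (f : (LaurentSeries F)[X]) (hf : f.Monic) (hi : Irreducible f)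
    (h0 : Valued.v (f.coeff 0) ≤ (1 : ℤᵐ⁰)) (i : ℕ) : Valued.v (f.coeff i) ≤ (1 : ℤᵐ⁰) := by
  obtain ⟨u, hu⟩ := LaurentSeries.valuation_surjective (K := F) (exp (-1 : ℤ))
  have : (Valued.v : Valuation (LaurentSeries F) ℤᵐ⁰).IsNontrivial := by
    refine ⟨⟨u, ?_, ?_⟩⟩
    · rw [hu]; simp
    · rw [hu, ← exp_zero, Ne, exp_inj]; decide
  have hm : MulArchimedean (MonoidWithZeroHom.ValueGroup₀ (.ofClass (Valued.v : Valuation (LaurentSeries F) ℤᵐ⁰))) := by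
    infer_instance
  obtain ⟨hr⟩ := (Valuation.nonempty_rankOne_iff_mulArchimedean (v := (Valued.v : Valuation (LaurentSeries F) ℤᵐ⁰))).2 hm
  let := hr
  let inst : NontriviallyNormedField (LaurentSeries F) := Valued.toNontriviallyNormedField (LaurentSeries F) ℤᵐ⁰
  have : IsUltrametricDist (LaurentSeries F) :=
    ⟨fun x y z ↦ by
      refine (Valuation.norm_add_le _ (x - y) (y - z)).trans_eq' ?_
      simp only [sub_add_sub_cancel]
      rfl⟩
  have : CompleteSpace (LaurentSeries F) := LaurentSeries.instLaurentSeriesComplete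
  have := Fact.mk hi
  have : FiniteDimensional (LaurentSeries F) (AdjoinRoot f) := (AdjoinRoot.powerBasis hf.ne_zero).finite
  have hmin : minpoly (LaurentSeries F) (AdjoinRoot.root f) = f := by
    rw [AdjoinRoot.minpoly_root hf.ne_zero]; simp [hf.leadingCoeff]
  have := spectralNorm.spectralNorm_eq_norm_coeff_zero_rpow (LaurentSeries F) (AdjoinRoot f) (AdjoinRoot.root f)
  rw [spectralNorm, hmin] at this
  have h0' : ‖f.coeff 0‖ ≤ 1 := Valued.toNormedField.norm_le_one_iff.2 h0
  have h1 : spectralValue f ≤ 1 := by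
    rw [this]; exact Real.rpow_le_one (norm_nonneg _) h0' (by positivity)
  rcases lt_trichotomy i f.natDegree with h | h | h
  · have h2 := (le_ciSup (spectralValueTerms_bddAbove f) i).trans h1
    rw [spectralValueTerms_of_lt_natDegree f h] at h2
    apply Valued.toNormedField.norm_le_one_iff.1
    by_contra hc
    push Not at hc
    have : (0:ℝ) < 1 / (f.natDegree - i : ℝ) := by
      have : (i:ℝ) < f.natDegree := by exact_mod_cast h
      apply one_div_pos.2; linarith
    exact absurd h2 (not_le.2 (Real.one_lt_rpow hc this))
  · subst h; rw [hf.coeff_natDegree]; simp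
  · rw [coeff_eq_zero_of_natDegree_lt h]; simp

lemma norm_minpoly (K D : Type) [Field K] [DivisionRing D] [Algebra K D] [FiniteDimensional K D] (x : D) :
    ∃ r n : ℕ, r ≠ 0 ∧ Algebra.norm K x = ((-1) ^ n * (minpoly K x).coeff 0) ^ r := by
  have hint : IsIntegral K x := Algebra.IsIntegral.isIntegral x
  have : Fact (Irreducible (minpoly K x)) := ⟨minpoly.irreducible hint⟩
  let φ : AdjoinRoot (minpoly K x) →+* D :=
    Ideal.Quotient.lift _ (aeval x : K[X] →ₐ[K] D).toRingHom (by
      intro a ha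
      obtain ⟨b, rfl⟩ := Ideal.mem_span_singleton'.1 ha
      simp)
  let : Module (AdjoinRoot (minpoly K x)) D := Module.compHom D φ
  have hsm : ∀ (a : AdjoinRoot (minpoly K x)) (d : D), a • d = φ a * d := fun a d => rfl
  have hφ : ∀ k : K, φ (algebraMap K _ k) = algebraMap K D k := fun k => by
    change aeval x (C k) = _
    simp
  have hroot : φ (AdjoinRoot.root _) = x := by
    change aeval x X = _
    simp
  have : IsScalarTower K (AdjoinRoot (minpoly K x)) D := ⟨fun k a d => by
    rw [hsm, hsm, Algebra.smul_def, map_mul, hφ, Algebra.smul_def, mul_assoc]⟩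
  have : FiniteDimensional K (AdjoinRoot (minpoly K x)) :=
    (AdjoinRoot.powerBasis (minpoly.ne_zero hint)).finite
  have : Module.Finite (AdjoinRoot (minpoly K x)) D := Module.Finite.of_restrictScalars_finite K _ D
  have hl : Algebra.lmul K D x = ((AdjoinRoot.root (minpoly K x)) • (LinearMap.id : D →ₗ[AdjoinRoot (minpoly K x)] D)).restrictScalars K := by
    ext d
    simp [hsm, hroot]
  have hpb := Algebra.PowerBasis.norm_gen_eq_coeff_zero_minpoly (AdjoinRoot.powerBasis (minpoly.ne_zero hint))
  rw [AdjoinRoot.powerBasis_gen, AdjoinRoot.minpoly_root (minpoly.ne_zero hint)] at hpb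
  refine ⟨Module.finrank (AdjoinRoot (minpoly K x)) D, (AdjoinRoot.powerBasis (minpoly.ne_zero hint)).dim, Module.finrank_pos.ne', ?_⟩
  rw [Algebra.norm_apply, hl, LinearMap.det_restrictScalars, LinearMap.det_smul, LinearMap.det_id, mul_one, map_pow, hpb]
  simp [(minpoly.monic hint).leadingCoeff]

section
variable {F : Type} [Field F] {D : Type} [DivisionRing D] [Algebra (LaurentSeries F) D]
    [FiniteDimensional (LaurentSeries F) D]

noncomputable def ww (x : D) : ℤᵐ⁰ := Valued.v (Algebra.norm (LaurentSeries F) x)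

local notation "w" => ww (F := F)

lemma ww_mul (x y : D) : w (x * y) = w x * w y := by simp [ww]
lemma ww_one : w (1 : D) = 1 := by simp [ww]
lemma ww_zero : w (0 : D) = 0 := by simp [ww]
lemma ww_pow (x : D) (n : ℕ) : w (x ^ n) = w x ^ n := by simp [ww]
lemma ww_eq_zero (x : D) : w x = 0 ↔ x = 0 := by simp [ww, Algebra.norm_eq_zero_iff]
lemma ww_algebraMap (k : LaurentSeries F) :
    w (algebraMap _ D k) = Valued.v k ^ Module.finrank (LaurentSeries F) D := by
  simp [ww, Algebra.norm_algebraMap]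

lemma ww_iff (x : D) : (w x ≤ 1 ↔ Valued.v ((minpoly (LaurentSeries F) x).coeff 0) ≤ (1 : ℤᵐ⁰)) ∧
    (w x < 1 ↔ Valued.v ((minpoly (LaurentSeries F) x).coeff 0) < (1 : ℤᵐ⁰)) := by
  obtain ⟨r, n, hr, h⟩ := norm_minpoly (LaurentSeries F) D x
  have : w x = Valued.v ((minpoly (LaurentSeries F) x).coeff 0) ^ r := by
    rw [ww, h]; simp
  rw [this]
  exact ⟨pow_le_one_iff hr, pow_lt_one_iff hr⟩

lemma int_poly (x : D) (hx : w x ≤ 1) : ∃ g : (PowerSeries F)[X],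
    minpoly (LaurentSeries F) x = g.map (HahnSeries.ofPowerSeries ℤ F) := by
  have hint : IsIntegral (LaurentSeries F) x := Algebra.IsIntegral.isIntegral x
  have := key_integral F _ (minpoly.monic hint) (minpoly.irreducible hint) ((ww_iff x).1.1 hx)
  have h2 : minpoly (LaurentSeries F) x ∈ Polynomial.lifts (HahnSeries.ofPowerSeries ℤ F) := by
    rw [Polynomial.lifts_iff_coeff_lifts]
    intro n
    obtain ⟨f, hf⟩ := (LaurentSeries.val_le_one_iff_eq_coe F _).1 (this n)
    exact ⟨f, hf⟩
  obtain ⟨g, hg⟩ := (Polynomial.mem_lifts _).1 h2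
  exact ⟨g, hg.symm⟩

lemma coeff_zero_sub (x : D) (k : LaurentSeries F) :
    (minpoly (LaurentSeries F) (x - algebraMap _ D k)).coeff 0 = (minpoly (LaurentSeries F) x).eval k := by
  have hint : IsIntegral (LaurentSeries F) x := Algebra.IsIntegral.isIntegral x
  have h : (minpoly (LaurentSeries F) x).comp (X + C k) =
      minpoly (LaurentSeries F) (x - algebraMap _ D k) := by
    refine minpoly.eq_of_irreducible_of_monic ?_ ?_ ((minpoly.monic hint).comp_X_add_C k)
    · have := (MulEquiv.irreducible_iff (Polynomial.algEquivAevalXAddC k)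
        (x := minpoly (LaurentSeries F) x)).2 (minpoly.irreducible hint)
      rwa [Polynomial.algEquivAevalXAddC_apply, ← Polynomial.comp_eq_aeval] at this
    · rw [Polynomial.comp_eq_aeval, ← Polynomial.aeval_algHom_apply]
      simp
  rw [← h, coeff_zero_eq_eval_zero]
  simp

lemma ww_add_one (x : D) (hx : w x ≤ 1) : w (x + 1) ≤ 1 := by
  obtain ⟨g, hg⟩ := int_poly x hx
  have : x + 1 = x - algebraMap (LaurentSeries F) D (-1) := by simp
  rw [this, (ww_iff _).1, coeff_zero_sub, hg]
  have : (-1 : LaurentSeries F) = HahnSeries.ofPowerSeries ℤ F (-1) := by simp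
  rw [this, eval_map_apply]
  exact (LaurentSeries.val_le_one_iff_eq_coe F _).2 ⟨_, rfl⟩

lemma val_lt_one (f : PowerSeries F) (hf : PowerSeries.constantCoeff f = 0) :
    Valued.v (HahnSeries.ofPowerSeries ℤ F f) < (1 : ℤᵐ⁰) := by
  obtain ⟨g, rfl⟩ := PowerSeries.X_dvd_iff.2 hf
  rw [map_mul, map_mul]
  have h1 : Valued.v (HahnSeries.ofPowerSeries ℤ F g) ≤ (1 : ℤᵐ⁰) := 
    (LaurentSeries.val_le_one_iff_eq_coe F _).2 ⟨_, rfl⟩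
  have h2 : Valued.v (HahnSeries.ofPowerSeries ℤ F PowerSeries.X) < (1 : ℤᵐ⁰) := by
    have := LaurentSeries.valuation_X_pow F 1
    rw [pow_one] at this
    rw [this, ← exp_zero, exp_lt_exp]; decide
  exact mul_lt_one_of_lt_of_le h2 h1

lemma ww_residue [IsAlgClosed F] (x : D) (hx : w x ≤ 1) :
    ∃ c : F, w (x - algebraMap (LaurentSeries F) D (HahnSeries.C c)) < 1 := by
  have hint : IsIntegral (LaurentSeries F) x := Algebra.IsIntegral.isIntegral x
  obtain ⟨g, hg⟩ := int_poly x hx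
  have hinj : Function.Injective (HahnSeries.ofPowerSeries ℤ F) := HahnSeries.ofPowerSeries_injective
  have hgm : g.Monic := by
    have := minpoly.monic hint
    rw [hg] at this
    exact Polynomial.monic_of_injective hinj this
  have hdeg : 0 < g.natDegree := by
    have := minpoly.natDegree_pos hint
    rwa [hg, natDegree_map_eq_of_injective hinj] at this
  obtain ⟨c, hc⟩ := IsAlgClosed.exists_root (g.map (PowerSeries.constantCoeff (R := F))) (by
    rw [hgm.degree_map, degree_eq_natDegree hgm.ne_zero]; exact_mod_cast hdeg.ne')
  refine ⟨c, ?_⟩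
  rw [(ww_iff _).2, coeff_zero_sub, hg, ← HahnSeries.ofPowerSeries_C, eval_map_apply]
  apply val_lt_one
  rw [← eval_map_apply, PowerSeries.constantCoeff_C]
  exact hc

lemma ww_add_le {x y : D} {a : ℤᵐ⁰} (hx : w x ≤ a) (hy : w y ≤ a) : w (x + y) ≤ a := by
  wlog h : w y ≤ w x generalizing x y
  · rw [add_comm]; exact this hy hx (le_of_not_ge h)
  by_cases hx0 : x = 0
  · subst hx0; simpa using hy
  refine le_trans ?_ hx
  have hpos : 0 < w x := zero_lt_iff.2 (by rwa [Ne, ww_eq_zero])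
  have e : x + y = (y * x⁻¹ + 1) * x := by
    rw [add_mul, mul_assoc, inv_mul_cancel₀ hx0, mul_one, one_mul, add_comm]
  have h1 : w (y * x⁻¹) * w x ≤ 1 * w x := by
    rw [← ww_mul, mul_assoc, inv_mul_cancel₀ hx0, mul_one, one_mul]; exact h
  have h2 : w (y * x⁻¹) ≤ 1 := le_of_mul_le_mul_right h1 hpos
  rw [e, ww_mul]
  exact mul_le_of_le_one_left' (ww_add_one _ h2)

lemma ww_neg (x : D) : w (-x) = w x := by
  have : -x = algebraMap (LaurentSeries F) D (-1) * x := by simp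
  rw [this, ww_mul, ww_algebraMap]; simp

lemma ww_sub_le {x y : D} {a : ℤᵐ⁰} (hx : w x ≤ a) (hy : w y ≤ a) : w (x - y) ≤ a := by
  rw [sub_eq_add_neg]; exact ww_add_le hx (by rwa [ww_neg])

lemma exists_unif : ∃ π : D, π ≠ 0 ∧ w π < 1 ∧ ∀ y : D, w y < 1 → w y ≤ w π := by
  let S : Set ℕ := {n | ∃ y : D, w y = exp (-(n + 1 : ℤ))}
  have hS : S.Nonempty := by
    obtain ⟨u, hu⟩ := LaurentSeries.valuation_surjective (K := F) (exp (-1 : ℤ))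
    have hp : 0 < Module.finrank (LaurentSeries F) D := Module.finrank_pos
    refine ⟨Module.finrank (LaurentSeries F) D - 1, algebraMap _ D u, ?_⟩
    rw [ww_algebraMap, hu, ← exp_nsmul]
    congr 1
    push_cast [hp]; simp
  classical
  obtain ⟨π, hπ⟩ := Nat.find_spec hS
  refine ⟨π, ?_, ?_, ?_⟩
  · rintro rfl; rw [ww_zero] at hπ; exact exp_ne_zero hπ.symm
  · rw [hπ, ← exp_zero, exp_lt_exp]; lia
  · intro y hy
    by_cases hy0 : w y = 0
    · rw [hy0]; exact zero_le
    rw [← exp_log hy0] at hy ⊢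
    rw [← exp_zero, exp_lt_exp] at hy
    rw [hπ, exp_le_exp]
    have : Nat.find hS ≤ (-log (w y) - 1).toNat := Nat.find_min' hS ⟨y, by
      rw [← exp_log hy0]; simp only [log_exp]; congr 1; lia⟩
    lia

lemma approx [IsAlgClosed F] {π : D} (h0 : π ≠ 0) (hmax : ∀ y : D, w y < 1 → w y ≤ w π)
    (x : D) (hx : w x ≤ 1) (n : ℕ) : ∃ p : (LaurentSeries F)[X], w (x - aeval π p) ≤ w π ^ n := by
  induction n with
  | zero => exact ⟨0, by simpa using hx⟩
  | succ n ih =>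
    obtain ⟨p, hp⟩ := ih
    have hpos : 0 < w (π ^ n) := zero_lt_iff.2 (by rw [Ne, ww_eq_zero]; exact pow_ne_zero _ h0)
    have e : (x - aeval π p) * (π ^ n)⁻¹ * π ^ n = x - aeval π p := by
      rw [mul_assoc, inv_mul_cancel₀ (pow_ne_zero _ h0), mul_one]
    have h1 : w ((x - aeval π p) * (π ^ n)⁻¹) ≤ 1 := by
      refine le_of_mul_le_mul_right ?_ hpos
      rw [← ww_mul, e, one_mul, ww_pow]; exact hp
    obtain ⟨c, hc⟩ := ww_residue _ h1
    refine ⟨p + C (HahnSeries.C c) * X ^ n, ?_⟩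
    have : x - aeval π (p + C (HahnSeries.C c) * X ^ n) =
        ((x - aeval π p) * (π ^ n)⁻¹ - algebraMap (LaurentSeries F) D (HahnSeries.C c)) * π ^ n := by
      rw [sub_mul, e]; simp [sub_sub]
    rw [this, ww_mul, ww_pow, pow_succ']
    exact mul_le_mul_left (hmax _ hc) _

lemma comm_int [IsAlgClosed F] (x y : D) (hx : w x ≤ 1) (hy : w y ≤ 1) : x * y = y * x := by
  obtain ⟨π, h0, h1, hmax⟩ := exists_unif (F := F) (D := D)
  rw [← sub_eq_zero, ← ww_eq_zero (F := F)]
  by_contra hne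
  obtain ⟨n, hn⟩ := exists_pow_lt₀ h1 (Units.mk0 _ hne)
  rw [Units.val_mk0] at hn
  refine absurd hn (not_lt.2 ?_)
  obtain ⟨p, hp⟩ := approx h0 hmax x hx n
  obtain ⟨q, hq⟩ := approx h0 hmax y hy n
  have hn1 : w π ^ n ≤ 1 := pow_le_one' h1.le n
  have hP : w (aeval π p) ≤ 1 := by
    have := ww_sub_le hx (hp.trans hn1); simpa using this
  have hQ : w (aeval π q) ≤ 1 := by
    have := ww_sub_le hy (hq.trans hn1); simpa using this
  have hc : aeval π p * aeval π q = aeval π q * aeval π p := by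
    rw [← map_mul, mul_comm, map_mul]
  have e : x * y - y * x = ((x - aeval π p) * y + aeval π p * (y - aeval π q))
      - ((y - aeval π q) * x + aeval π q * (x - aeval π p)) := by
    have : x * y - y * x = ((x - aeval π p) * y + aeval π p * (y - aeval π q))
      - ((y - aeval π q) * x + aeval π q * (x - aeval π p)) + (aeval π p * aeval π q - aeval π q * aeval π p) := by
      noncomm_ring
    rw [this, hc, sub_self, add_zero]
  rw [e]
  refine ww_sub_le (ww_add_le ?_ ?_) (ww_add_le ?_ ?_) <;> rw [ww_mul]
  · exact mul_le_of_le_of_le_one hp hy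
  · exact mul_le_of_le_one_of_le hP hq
  · exact mul_le_of_le_of_le_one hq hx
  · exact mul_le_of_le_one_of_le hQ hp

lemma comm_all [IsAlgClosed F] (x y : D) : x * y = y * x := by
  wlog hx : w x ≤ 1 generalizing x y
  · have hx0 : x ≠ 0 := by rintro rfl; rw [ww_zero] at hx; exact hx zero_le
    have hi : w x⁻¹ ≤ 1 := by
      have : w x⁻¹ * w x = 1 := by rw [← ww_mul, inv_mul_cancel₀ hx0, ww_one]
      rw [← this]
      exact le_mul_of_one_le_right' (le_of_not_ge hx)
    have h : Commute x⁻¹ y := this x⁻¹ y hi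
    exact (Commute.inv_left_iff₀.1 h)
  wlog hy : w y ≤ 1 generalizing x y
  · have hy0 : y ≠ 0 := by rintro rfl; rw [ww_zero] at hy; exact hy zero_le
    have hi : w y⁻¹ ≤ 1 := by
      have : w y⁻¹ * w y = 1 := by rw [← ww_mul, inv_mul_cancel₀ hy0, ww_one]
      rw [← this]
      exact le_mul_of_one_le_right' (le_of_not_ge hy)
    have h : Commute x y⁻¹ := this x y⁻¹ hx hi
    exact (Commute.inv_right_iff₀.1 h)
  exact comm_int x y hx hy

end

theorem statement_14
    (F : Type) [Field F] [IsAlgClosed F]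
    (D : Type) [DivisionRing D] [Algebra (LaurentSeries F) D]
    [FiniteDimensional (LaurentSeries F) D]
    (hcenter : Subalgebra.center (LaurentSeries F) D = ⊥) :
    Module.finrank (LaurentSeries F) D = 1 := by
  rw [← Subalgebra.bot_eq_top_iff_finrank_eq_one, ← hcenter, eq_top_iff]
  intro x _
  rw [Subalgebra.mem_center_iff]
  exact fun y => comm_all (F := F) y x
end

section
/- Let Y be a smooth projective geometrically connected curve over a perfect field F, with function field k. For every closed point x of Y, let Res_x : Ω¹_{k/F} → κ(x) denote the residue map at x. Then for every rational differential form ω ∈ Ω¹_{k/F}, the sum ∑_x Tr_{κ(x)/F}(Res_x(ω)) over all closed points x of Y equals 0 in F. -/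
namespace ResThm

section Trace

variable {F : Type} [Field F]
variable {V W U : Type} [AddCommGroup V] [Module F V] [AddCommGroup W] [Module F W]
  [AddCommGroup U] [Module F U]

/-- finite rank linear maps -/
def FR (T : V →ₗ[F] W) : Prop := ∃ X : Submodule F W, FiniteDimensional F X ∧ ∀ v, T v ∈ X

/-- trace of a finite rank endomorphism (computed on its range) -/
noncomputable def ftr (T : V →ₗ[F] V) : F :=
  LinearMap.trace F (LinearMap.range T)
    (T.restrict (p := LinearMap.range T) (q := LinearMap.range T)
      (fun x _ => LinearMap.mem_range_self T x))

lemma ftr_eq (T : V →ₗ[F] V) (X : Submodule F V) [FiniteDimensional F X] (h : ∀ v, T v ∈ X) :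
    ftr T = LinearMap.trace F X (T.restrict (p := X) (q := X) (fun x _ => h x)) := by
  have hle : LinearMap.range T ≤ X := by rintro _ ⟨v, rfl⟩; exact h v
  have hfd : FiniteDimensional F (LinearMap.range T) := Submodule.finiteDimensional_of_le hle
  -- maps X → range T, range T → X
  let a : X →ₗ[F] LinearMap.range T := T.rangeRestrict ∘ₗ X.subtype
  let b : LinearMap.range T →ₗ[F] X := Submodule.inclusion hle
  have := LinearMap.trace_comp_comm' a b
  rw [ftr]
  convert! this.symm using 2

lemma FR.comp_left {T : V →ₗ[F] W} (h : FR T) (A : W →ₗ[F] U) : FR (A ∘ₗ T) := by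
  obtain ⟨X, hX, hT⟩ := h
  exact ⟨X.map A, inferInstance, fun v => Submodule.mem_map_of_mem (hT v)⟩

lemma FR.comp_right {T : V →ₗ[F] W} (h : FR T) (A : U →ₗ[F] V) : FR (T ∘ₗ A) := by
  obtain ⟨X, hX, hT⟩ := h
  exact ⟨X, hX, fun v => hT _⟩

lemma FR.add {T S : V →ₗ[F] W} (h : FR T) (h' : FR S) : FR (T + S) := by
  obtain ⟨X, hX, hT⟩ := h
  obtain ⟨Y, hY, hS⟩ := h'
  exact ⟨X ⊔ Y, inferInstance, fun v => Submodule.add_mem_sup (hT v) (hS v)⟩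

lemma FR.neg {T : V →ₗ[F] W} (h : FR T) : FR (-T) := by
  obtain ⟨X, hX, hT⟩ := h
  exact ⟨X, hX, fun v => X.neg_mem (hT v)⟩

lemma FR.sub {T S : V →ₗ[F] W} (h : FR T) (h' : FR S) : FR (T - S) := by
  rw [sub_eq_add_neg]; exact h.add h'.neg

lemma FR.zero : FR (0 : V →ₗ[F] W) := ⟨⊥, inferInstance, fun v => by simp⟩

lemma FR.sum {ι : Type} (s : Finset ι) (T : ι → V →ₗ[F] W) (h : ∀ i ∈ s, FR (T i)) :
    FR (∑ i ∈ s, T i) := by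
  classical
  induction s using Finset.induction_on with
  | empty => simpa using FR.zero
  | insert a s ha ih =>
    rw [Finset.sum_insert ha]
    exact (h a (by simp)).add (ih fun i hi => h i (by simp [hi]))

lemma FR.of_finite [FiniteDimensional F W] (T : V →ₗ[F] W) : FR T :=
  ⟨⊤, inferInstance, fun v => by simp⟩

lemma FR.of_finite' [FiniteDimensional F V] (T : V →ₗ[F] W) : FR T :=
  ⟨LinearMap.range T, inferInstance, fun v => by simp⟩

lemma ftr_add {T S : V →ₗ[F] V} (h : FR T) (h' : FR S) : ftr (T + S) = ftr T + ftr S := by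
  obtain ⟨X, hX, hT⟩ := h
  obtain ⟨Y, hY, hS⟩ := h'
  rw [ftr_eq T (X ⊔ Y) fun v => Submodule.mem_sup_left (hT v),
    ftr_eq S (X ⊔ Y) fun v => Submodule.mem_sup_right (hS v),
    ftr_eq (T + S) (X ⊔ Y) fun v => Submodule.add_mem_sup (hT v) (hS v), ← map_add]
  rfl

lemma ftr_zero : ftr (0 : V →ₗ[F] V) = 0 := by
  rw [ftr_eq 0 ⊥ (by simp)]
  exact map_zero (LinearMap.trace F _)

lemma ftr_neg {T : V →ₗ[F] V} (h : FR T) : ftr (-T) = - ftr T := by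
  have := ftr_add h h.neg
  rw [add_neg_cancel, ftr_zero] at this
  exact (neg_eq_of_add_eq_zero_right this.symm).symm

lemma ftr_sub {T S : V →ₗ[F] V} (h : FR T) (h' : FR S) : ftr (T - S) = ftr T - ftr S := by
  rw [sub_eq_add_neg, ftr_add h h'.neg, ftr_neg h', sub_eq_add_neg]

lemma ftr_sum {ι : Type} (s : Finset ι) (T : ι → V →ₗ[F] V) (h : ∀ i ∈ s, FR (T i)) :
    ftr (∑ i ∈ s, T i) = ∑ i ∈ s, ftr (T i) := by
  classical
  induction s using Finset.induction_on with
  | empty => simpa using ftr_zero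
  | insert a s ha ih =>
    rw [Finset.sum_insert ha, Finset.sum_insert ha, ftr_add (h a (by simp))
      (FR.sum _ _ fun i hi => h i (by simp [hi])), ih fun i hi => h i (by simp [hi])]

lemma ftr_comm (A : V →ₗ[F] W) (B : W →ₗ[F] V) (h : FR A) : ftr (A ∘ₗ B) = ftr (B ∘ₗ A) := by
  obtain ⟨X, hX, hA⟩ := h
  rw [ftr_eq (A ∘ₗ B) X (fun v => hA _),
    ftr_eq (B ∘ₗ A) (X.map B) (fun v => Submodule.mem_map_of_mem (hA v))]
  let a : X.map B →ₗ[F] X := A.restrict (p := X.map B) (q := X) (fun x _ => hA x)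
  let b : X →ₗ[F] X.map B := B.restrict (fun x hx => Submodule.mem_map_of_mem hx)
  exact LinearMap.trace_comp_comm' b a

lemma ftr_finite [FiniteDimensional F V] (T : V →ₗ[F] V) : ftr T = LinearMap.trace F V T := by
  rw [ftr_eq T ⊤ (by simp)]
  let e : (⊤ : Submodule F V) ≃ₗ[F] V := Submodule.topEquiv
  rw [← LinearMap.trace_conj' _ e]
  congr 1

/-- existence of a parametrix -/
lemma exists_parametrix (φ : V →ₗ[F] W) (hker : FiniteDimensional F (LinearMap.ker φ))
    (hcok : ∃ X : Submodule F W, FiniteDimensional F X ∧ LinearMap.range φ ⊔ X = ⊤) :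
    ∃ ψ : W →ₗ[F] V, FR (φ ∘ₗ ψ - LinearMap.id) ∧ FR (ψ ∘ₗ φ - LinearMap.id) := by
  obtain ⟨X, hX, hsup⟩ := hcok
  obtain ⟨r, hr⟩ := (LinearMap.range φ).exists_isCompl
  obtain ⟨s, hs⟩ := φ.rangeRestrict.exists_rightInverse_of_surjective φ.range_rangeRestrict
  have hs' : ∀ y, φ (s y) = y := fun y => congrArg Subtype.val (LinearMap.congr_fun hs y)
  let p := Submodule.projectionOnto (LinearMap.range φ) r hr
  have hp : ∀ y : LinearMap.range φ, p y = y := fun y => by simp [p]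
  refine ⟨s ∘ₗ p, ⟨X.map (LinearMap.id - (LinearMap.range φ).subtype ∘ₗ p), inferInstance, ?_⟩,
    ⟨LinearMap.ker φ, hker, ?_⟩⟩
  · intro w
    have hw : w ∈ LinearMap.range φ ⊔ X := by rw [hsup]; trivial
    obtain ⟨y, hy, x, hx, rfl⟩ := Submodule.mem_sup.1 hw
    have h1 := hp ⟨y, hy⟩
    simp only at h1
    refine ⟨-x, X.neg_mem hx, ?_⟩
    simp [hs', h1]
    abel
  · intro v
    have h1 := hp ⟨φ v, by simp⟩
    simp only at h1
    simp [hs', h1]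

/-- Key abstract lemma. -/
theorem ftr_commutator_eq_zero (φ : V →ₗ[F] W) (hker : FiniteDimensional F (LinearMap.ker φ))
    (hcok : ∃ X : Submodule F W, FiniteDimensional F X ∧ LinearMap.range φ ⊔ X = ⊤)
    (f g : V →ₗ[F] V) (hfg : f ∘ₗ g = g ∘ₗ f) (S T : W →ₗ[F] W)
    (hS : FR (S ∘ₗ φ - φ ∘ₗ f)) (hT : FR (T ∘ₗ φ - φ ∘ₗ g)) :
    FR (S ∘ₗ T - T ∘ₗ S) ∧ ftr (S ∘ₗ T - T ∘ₗ S) = 0 := by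
  obtain ⟨ψ, h1, h2⟩ := exists_parametrix φ hker hcok
  set K := ψ ∘ₗ φ - LinearMap.id with hK
  have hψφ : ψ ∘ₗ φ = LinearMap.id + K := by rw [hK]; abel
  set R := S - φ ∘ₗ f ∘ₗ ψ with hR
  set Q := T - φ ∘ₗ g ∘ₗ ψ with hQ
  have hRf : FR R := by
    have : R = (S ∘ₗ φ - φ ∘ₗ f) ∘ₗ ψ - S ∘ₗ (φ ∘ₗ ψ - LinearMap.id) := by
      rw [hR]; ext v; simp
    rw [this]
    exact (hS.comp_right _).sub (h1.comp_left _)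
  have hQf : FR Q := by
    have : Q = (T ∘ₗ φ - φ ∘ₗ g) ∘ₗ ψ - T ∘ₗ (φ ∘ₗ ψ - LinearMap.id) := by
      rw [hQ]; ext v; simp
    rw [this]
    exact (hT.comp_right _).sub (h1.comp_left _)
  have hψφ' : ∀ v, ψ (φ v) = v + K v := fun v => LinearMap.congr_fun hψφ v
  have hfg' : ∀ v, f (g v) = g (f v) := fun v => LinearMap.congr_fun hfg v
  have hSe : S = φ ∘ₗ f ∘ₗ ψ + R := by rw [hR]; abel
  have hTe : T = φ ∘ₗ g ∘ₗ ψ + Q := by rw [hQ]; abel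
  have key : S ∘ₗ T - T ∘ₗ S =
      ((φ ∘ₗ f) ∘ₗ (K ∘ₗ g ∘ₗ ψ) - (φ ∘ₗ g) ∘ₗ (K ∘ₗ f ∘ₗ ψ)) +
      ((R ∘ₗ T - T ∘ₗ R) + ((φ ∘ₗ f ∘ₗ ψ) ∘ₗ Q - Q ∘ₗ (φ ∘ₗ f ∘ₗ ψ))) := by
    have e : T ∘ₗ R = (φ ∘ₗ g ∘ₗ ψ) ∘ₗ R + Q ∘ₗ R := by
      conv_lhs => rw [hTe]
      rfl
    rw [e]
    conv_lhs => rw [hSe, hTe]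
    conv_rhs => rw [hTe]
    ext v
    simp only [LinearMap.sub_apply, LinearMap.add_apply, LinearMap.comp_apply, hψφ', map_add, hfg']
    abel
  have k1 : FR (K ∘ₗ g ∘ₗ ψ) := h2.comp_right _
  have k2 : FR (K ∘ₗ f ∘ₗ ψ) := h2.comp_right _
  have k3 := k1.comp_left (φ ∘ₗ f)
  have k4 := k2.comp_left (φ ∘ₗ g)
  have r1 := hRf.comp_right T
  have r2 := hRf.comp_left T
  have q1 := hQf.comp_left (φ ∘ₗ f ∘ₗ ψ)
  have q2 := hQf.comp_right (φ ∘ₗ f ∘ₗ ψ)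
  refine ⟨?_, ?_⟩
  · rw [key]
    exact (k3.sub k4).add ((r1.sub r2).add (q1.sub q2))
  · rw [key, ftr_add (k3.sub k4) ((r1.sub r2).add (q1.sub q2)),
      ftr_add (r1.sub r2) (q1.sub q2), ftr_sub r1 r2, ftr_sub q1 q2, ftr_sub k3 k4,
      ftr_comm R T hRf, ← ftr_comm Q _ hQf, ← ftr_comm _ (φ ∘ₗ f) k1, ← ftr_comm _ (φ ∘ₗ g) k2]
    have a1 : (K ∘ₗ g ∘ₗ ψ) ∘ₗ φ ∘ₗ f = K ∘ₗ g ∘ₗ f + (K ∘ₗ g) ∘ₗ (K ∘ₗ f) := by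
      ext v; simp [hψφ']
    have a2 : (K ∘ₗ f ∘ₗ ψ) ∘ₗ φ ∘ₗ g = K ∘ₗ g ∘ₗ f + (K ∘ₗ f) ∘ₗ (K ∘ₗ g) := by
      ext v; simp [hψφ', hfg']
    have b1 : FR (K ∘ₗ g ∘ₗ f) := h2.comp_right _
    have b2 : FR (K ∘ₗ g) := h2.comp_right _
    have b3 : FR (K ∘ₗ f) := h2.comp_right _
    rw [a1, a2, ftr_add b1 (b2.comp_right _), ftr_add b1 (b3.comp_right _), ftr_comm _ _ b2]
    ring

end Trace

end ResThm


namespace ResThm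

section Local

open HahnSeries

lemma coeff_mul_range {κ : Type} [Field κ] (f g : LaurentSeries κ) (a b n : ℤ)
    (hf : ∀ i < a, f.coeff i = 0) (hg : ∀ i < b, g.coeff i = 0) :
    (f * g).coeff n = ∑ i ∈ Finset.Icc a (n - b), f.coeff i * g.coeff (n - i) := by
  rw [HahnSeries.coeff_mul]
  symm
  have h1 : ∀ p ∈ Finset.antidiagonal f.isPWO_support g.isPWO_support n,
      p.1 ∈ Finset.Icc a (n - b) := by
    rintro ⟨i, j⟩ hp
    simp only [Finset.mem_antidiagonal, mem_support] at hp
    simp only [Finset.mem_Icc]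
    constructor
    · by_contra! h
      exact hp.1 (hf i h)
    · by_contra! h
      exact hp.2.1 (hg j (by omega))
  rw [← Finset.sum_subset (s₁ := (Finset.antidiagonal f.isPWO_support g.isPWO_support n).image
    Prod.fst)]
  · rw [Finset.sum_image]
    · refine Finset.sum_congr rfl ?_
      rintro ⟨i, j⟩ hp
      simp only [Finset.mem_antidiagonal, mem_support] at hp
      have : n - i = j := by omega
      simp [this]
    · rintro ⟨i, j⟩ hp ⟨i', j'⟩ hp' h
      simp only [Finset.mem_coe, Finset.mem_antidiagonal, mem_support] at hp hp'
      simp only at h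
      ext
      · exact h
      · simp only; omega
  · intro i hi
    obtain ⟨p, hp, rfl⟩ := Finset.mem_image.1 hi
    exact h1 p hp
  · intro i hi hni
    by_contra h
    apply hni
    rw [Finset.mem_image]
    refine ⟨(i, n - i), ?_, rfl⟩
    simp only [Finset.mem_antidiagonal, mem_support]
    exact ⟨left_ne_zero_of_mul h, right_ne_zero_of_mul h, by ring⟩

lemma exists_bound {κ : Type} [Field κ] (f : LaurentSeries κ) :
    ∃ M : ℕ, ∀ i < -(M : ℤ), f.coeff i = 0 := by
  refine ⟨(-f.order).toNat, fun i hi => coeff_eq_zero_of_lt_order ?_⟩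
  omega

lemma sum_Icc_symm {κ : Type} [Field κ] (b : ℤ → κ) (M : ℕ) :
    ∑ i ∈ Finset.Icc (-(M : ℤ)) M, b i =
      b 0 + ∑ s ∈ Finset.range M, (b (s + 1) + b (-(s + 1))) := by
  induction M with
  | zero => simp
  | succ M ih =>
    rw [Finset.sum_range_succ, ← add_assoc, ← ih]
    have : Finset.Icc (-((M + 1 : ℕ) : ℤ)) ((M + 1 : ℕ) : ℤ) =
        insert (-(M + 1 : ℤ)) (insert (M + 1 : ℤ) (Finset.Icc (-(M : ℤ)) M)) := by
      ext i; simp only [Finset.mem_Icc, Finset.mem_insert]; omega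
    rw [this, Finset.sum_insert, Finset.sum_insert]
    · ring
    · simp
    · simp only [Finset.mem_insert, Finset.mem_Icc]; omega

lemma sum_sum_eq {κ : Type} [Field κ] (a : ℕ → κ) (M : ℕ) (ha : ∀ s, M ≤ s → a s = 0) :
    ∑ n ∈ Finset.range M, ∑ m ∈ Finset.range M, a (n + m) =
      ∑ s ∈ Finset.range M, ((s : κ) + 1) * a s := by
  have h1 : ∀ n ∈ Finset.range M, ∑ m ∈ Finset.range M, a (n + m) =
      ∑ s ∈ Finset.Ico n M, a s := by
    intro n hn
    rw [Finset.mem_range] at hn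
    rw [Finset.sum_Ico_eq_sum_range]
    symm
    apply Finset.sum_subset
    · intro m; simp only [Finset.mem_range]; omega
    · intro m _ hm
      apply ha
      simp only [Finset.mem_range] at hm
      omega
  rw [Finset.sum_congr rfl h1, Finset.range_eq_Ico, Finset.sum_Ico_Ico_comm]
  refine Finset.sum_congr rfl fun s _ => ?_
  simp

variable (F : Type) [Field F] (κ : Type) [Field κ] [Algebra F κ]

/-- Principal parts. -/
def Neg : Submodule F (LaurentSeries κ) where
  carrier := {f | ∀ n : ℤ, 0 ≤ n → f.coeff n = 0}
  add_mem' := by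
    intro a b ha hb n hn
    simp [ha n hn, hb n hn]
  zero_mem' := by intro n hn; simp
  smul_mem' := by
    intro c x hx n hn
    simp [hx n hn]

/-- principal part of a Laurent series -/
noncomputable def pp : LaurentSeries κ →ₗ[F] Neg F κ :=
  LinearMap.codRestrict (Neg F κ) (truncLTLinearMap F 0) (fun f n hn => by
    simp [HahnSeries.coeff_truncLT, not_lt.2 hn])

lemma pp_coeff (f : LaurentSeries κ) (n : ℤ) :
    (pp F κ f : LaurentSeries κ).coeff n = if n < 0 then f.coeff n else 0 := by
  change (truncLT 0 f).coeff n = _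
  rw [HahnSeries.coeff_truncLT]

lemma pp_coe (f : Neg F κ) : pp F κ f = f := by
  ext n
  rw [pp_coeff]
  split_ifs with h
  · rfl
  · exact (f.2 n (not_lt.1 h)).symm

variable {κ}

lemma pp_eq_zero_iff (f : LaurentSeries κ) : pp F κ f = 0 ↔ ∀ n < 0, f.coeff n = 0 := by
  constructor
  · intro h n hn
    have := pp_coeff F κ f n
    rw [h, if_pos hn] at this
    simpa using this.symm
  · intro h
    ext n
    rw [pp_coeff]
    split_ifs with hn
    · simp [h n hn]
    · simp

lemma smul_eq_C_mul (c : F) (x : LaurentSeries κ) : c • x = C (algebraMap F κ c) * x := by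
  rw [HahnSeries.C_mul_eq_smul]
  ext n
  simp only [HahnSeries.coeff_smul, algebraMap_smul]

/-- multiplication as an `F`-linear map -/
noncomputable def mulL (f : LaurentSeries κ) : LaurentSeries κ →ₗ[F] LaurentSeries κ where
  toFun x := f * x
  map_add' := mul_add f
  map_smul' c x := by
    simp only [RingHom.id_apply, smul_eq_C_mul]
    ring

lemma mulL_apply (f x : LaurentSeries κ) : mulL F f x = f * x := rfl

/-- compression of the multiplication to principal parts -/
noncomputable def cmul (f : LaurentSeries κ) : Neg F κ →ₗ[F] Neg F κ :=
  pp F κ ∘ₗ mulL F f ∘ₗ (Neg F κ).subtype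

/-- Hankel-type operator -/
noncomputable def hank (g : LaurentSeries κ) : LaurentSeries κ →ₗ[F] Neg F κ :=
  pp F κ ∘ₗ mulL F g ∘ₗ (LinearMap.id - (Neg F κ).subtype ∘ₗ pp F κ)

lemma hank_apply (g h : LaurentSeries κ) :
    hank F g h = pp F κ (g * (h - (pp F κ h : LaurentSeries κ))) := rfl

lemma cmul_apply (g : LaurentSeries κ) (h : Neg F κ) :
    cmul F g h = pp F κ (g * (h : LaurentSeries κ)) := rfl

/-- block of the Hankel operator -/
noncomputable def blk (g : LaurentSeries κ) (n : ℤ) : κ →ₗ[F] Neg F κ :=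
  pp F κ ∘ₗ mulL F g ∘ₗ single.linearMap n

lemma blk_coeff (g : LaurentSeries κ) (n : ℤ) (c : κ) (j : ℤ) :
    (blk F g n c : LaurentSeries κ).coeff j = if j < 0 then g.coeff (j - n) * c else 0 := by
  change (pp F κ (g * single n c) : LaurentSeries κ).coeff j = _
  rw [pp_coeff, coeff_mul_single]

lemma hank_eq (g : LaurentSeries κ) (M : ℕ) (hg : ∀ i < -(M : ℤ), g.coeff i = 0) :
    hank F g = ∑ n ∈ Finset.range M, blk F g n ∘ₗ coeff.linearMap (n : ℤ) := by
  ext h j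
  rw [hank_apply, pp_coeff]
  have e : ((∑ n ∈ Finset.range M, blk F g n ∘ₗ coeff.linearMap (R := F) (n : ℤ)) h :
      LaurentSeries κ).coeff j =
      ∑ n ∈ Finset.range M, (blk F g n (h.coeff n) : LaurentSeries κ).coeff j := by
    rw [LinearMap.sum_apply, Submodule.coe_sum, HahnSeries.coeff_sum]
    rfl
  rw [e]
  simp only [blk_coeff]
  split_ifs with hj
  · rw [mul_comm, coeff_mul_range _ g 0 (-(M : ℤ)) j _ hg]
    · have e2 : ∀ i ∈ Finset.Icc 0 (j - -(M : ℤ)),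
          (h - (pp F κ h : LaurentSeries κ)).coeff i * g.coeff (j - i) =
            g.coeff (j - i) * h.coeff i := by
        intro i hi
        rw [Finset.mem_Icc] at hi
        rw [HahnSeries.coeff_sub, pp_coeff, if_neg (by omega)]
        ring
      rw [Finset.sum_congr rfl e2]
      rw [← Finset.sum_image (s := Finset.range M) (g := fun n : ℕ => (n : ℤ))
        (f := fun i => g.coeff (j - i) * h.coeff i) (by intro a _ b _ h; simpa using h)]
      apply Finset.sum_subset
      · intro i hi
        rw [Finset.mem_Icc] at hi
        rw [Finset.mem_image]
        refine ⟨i.toNat, ?_, ?_⟩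
        · rw [Finset.mem_range]; omega
        · omega
      · intro i hi hi2
        rw [Finset.mem_image] at hi
        obtain ⟨n, hn, rfl⟩ := hi
        simp only [Finset.mem_Icc, not_and, not_le] at hi2
        rw [hg _ (by have := hi2 (by omega); omega), zero_mul]
    · intro i hi
      rw [HahnSeries.coeff_sub, pp_coeff, if_pos hi, sub_self]
  · simp

lemma cmul_comm_eq (f g : LaurentSeries κ) :
    cmul F f ∘ₗ cmul F g - cmul F g ∘ₗ cmul F f =
      hank F g ∘ₗ mulL F f ∘ₗ (Neg F κ).subtype -
      hank F f ∘ₗ mulL F g ∘ₗ (Neg F κ).subtype := by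
  apply LinearMap.ext
  intro h
  simp only [LinearMap.sub_apply, LinearMap.comp_apply, hank_apply, cmul_apply,
    mulL_apply, Submodule.subtype_apply, mul_sub, map_sub]
  rw [show f * (g * (h : LaurentSeries κ)) = g * (f * h) by ring]
  abel

variable [FiniteDimensional F κ]

lemma FR_hank (g : LaurentSeries κ) : FR (hank F g) := by
  obtain ⟨M, hM⟩ := exists_bound g
  rw [hank_eq F g M hM]
  exact FR.sum _ _ fun n _ => (FR.of_finite' _).comp_right _

lemma ftr_hank (f g : LaurentSeries κ) (M : ℕ) (hf : ∀ i < -(M : ℤ), f.coeff i = 0)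
    (hg : ∀ i < -(M : ℤ), g.coeff i = 0) :
    ftr (hank F g ∘ₗ mulL F f ∘ₗ (Neg F κ).subtype) =
      Algebra.trace F κ (∑ s ∈ Finset.range M,
        ((s : κ) + 1) * (f.coeff (s + 1) * g.coeff (-(s + 1)))) := by
  have e : hank F g ∘ₗ mulL F f ∘ₗ (Neg F κ).subtype =
      ∑ n ∈ Finset.range M, blk F g n ∘ₗ
        (coeff.linearMap (n : ℤ) ∘ₗ mulL F f ∘ₗ (Neg F κ).subtype) := by
    rw [hank_eq F g M hg]
    apply LinearMap.ext
    intro h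
    simp only [LinearMap.comp_apply, LinearMap.sum_apply]
  rw [e, ftr_sum _ _ fun n _ => (FR.of_finite' _).comp_right _]
  have e2 : ∀ n ∈ Finset.range M, ftr (blk F g n ∘ₗ
        (coeff.linearMap (n : ℤ) ∘ₗ mulL F f ∘ₗ (Neg F κ).subtype)) =
      Algebra.trace F κ (∑ m ∈ Finset.range M,
        f.coeff ((n + m : ℕ) + 1) * g.coeff (-((n + m : ℕ) + 1))) := by
    intro n hn
    rw [ftr_comm _ _ (FR.of_finite' _), ftr_finite, Algebra.trace_apply]
    congr 1
    apply LinearMap.ext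
    intro c
    change (f * (blk F g n c : LaurentSeries κ)).coeff n = _ * c
    rw [mul_comm, coeff_mul_range _ f (-(M : ℤ)) (-(M : ℤ)) n _ hf]
    · have e3 : Finset.image (fun m : ℕ => -1 - (m : ℤ)) (Finset.range M) ⊆
          Finset.Icc (-(M : ℤ)) (n - -(M : ℤ)) := by
        intro i hi
        rw [Finset.mem_image] at hi
        obtain ⟨m, hm, rfl⟩ := hi
        rw [Finset.mem_range] at hm
        rw [Finset.mem_Icc]
        omega
      rw [← Finset.sum_subset e3]
      · rw [Finset.sum_image (by intro a _ b _ h; simpa using h), Finset.sum_mul]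
        refine Finset.sum_congr rfl fun m _ => ?_
        rw [blk_coeff, if_pos (by omega)]
        rw [show (-1 - (m : ℤ) - n) = -((n + m : ℕ) + 1) by push_cast; ring,
          show ((n : ℤ) - (-1 - m)) = (n + m : ℕ) + 1 by push_cast; ring]
        ring
      · intro i hi hi2
        rw [blk_coeff, if_neg, zero_mul]
        intro h
        apply hi2
        rw [Finset.mem_Icc] at hi
        rw [Finset.mem_image]
        exact ⟨(-1 - i).toNat, by rw [Finset.mem_range]; omega, by omega⟩
    · intro i hi
      rw [blk_coeff]
      split_ifs
      · rw [hg _ (by omega), zero_mul]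
      · rfl
  rw [Finset.sum_congr rfl e2, ← map_sum,
    sum_sum_eq (fun s : ℕ => f.coeff ((s : ℤ) + 1) * g.coeff (-((s : ℤ) + 1))) M]
  intro s hs
  rw [hg _ (by omega), mul_zero]

lemma residue_eq (f g : LaurentSeries κ) (M : ℕ) (hf : ∀ i < -(M : ℤ), f.coeff i = 0)
    (hg : ∀ i < -(M : ℤ), g.coeff i = 0) :
    (f * lseriesDeriv g).coeff (-1) =
      ∑ s ∈ Finset.range M, ((s : κ) + 1) * (g.coeff (s + 1) * f.coeff (-(s + 1))) -
      ∑ s ∈ Finset.range M, ((s : κ) + 1) * (f.coeff (s + 1) * g.coeff (-(s + 1))) := by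
  have hd : ∀ n, (lseriesDeriv g).coeff n = ((n + 1 : ℤ) : κ) * g.coeff (n + 1) := by
    intro n
    change (n + 1 : ℤ) • g.coeff (n + 1) = _
    rw [zsmul_eq_mul]
  rw [coeff_mul_range f _ (-(M : ℤ)) (-(M : ℤ) - 1) (-1) hf]
  · rw [show (-1 - (-(M : ℤ) - 1)) = M by ring, sum_Icc_symm, ← Finset.sum_sub_distrib]
    simp only [hd]
    simp only [sub_zero, Int.reduceNeg, neg_add_cancel, Int.cast_zero, zero_mul, mul_zero, zero_add]
    refine Finset.sum_congr rfl fun s _ => ?_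
    rw [show (-1 - ((s : ℤ) + 1) + 1) = -(s + 1) by ring,
      show (-1 - -((s : ℤ) + 1) + 1) = s + 1 by ring]
    push_cast
    ring
  · intro i hi
    rw [hd, hg _ (by omega), mul_zero]

theorem ftr_local (f g : LaurentSeries κ) :
    FR (cmul F f ∘ₗ cmul F g - cmul F g ∘ₗ cmul F f) ∧
    ftr (cmul F f ∘ₗ cmul F g - cmul F g ∘ₗ cmul F f) =
      - Algebra.trace F κ ((f * lseriesDeriv g).coeff (-1)) := by
  obtain ⟨M1, hM1⟩ := exists_bound f
  obtain ⟨M2, hM2⟩ := exists_bound g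
  have hf : ∀ i < -((max M1 M2 : ℕ) : ℤ), f.coeff i = 0 := fun i hi => hM1 i (by omega)
  have hg : ∀ i < -((max M1 M2 : ℕ) : ℤ), g.coeff i = 0 := fun i hi => hM2 i (by omega)
  have h1 := (FR_hank F g).comp_right (mulL F f ∘ₗ (Neg F κ).subtype)
  have h2 := (FR_hank F f).comp_right (mulL F g ∘ₗ (Neg F κ).subtype)
  rw [cmul_comm_eq]
  refine ⟨h1.sub h2, ?_⟩
  rw [ftr_sub h1 h2, ftr_hank F f g _ hf hg, ftr_hank F g f _ hg hf, residue_eq f g _ hf hg,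
    map_sub]
  ring

end Local

end ResThm


namespace ResThm

section WA

open WithZero Filter

variable {k : Type} [Field k] {I : Type} (v : I → Valuation k (WithZero (Multiplicative ℤ)))

lemma sep_two (hsep : ∀ x y, x ≠ y → ∃ a, v x a ≤ 1 ∧ 1 < v y a) (x y : I) (h : x ≠ y) :
    ∃ z, v x z < 1 ∧ 1 < v y z := by
  obtain ⟨a, ha1, ha2⟩ := hsep x y h
  obtain ⟨b, hb1, hb2⟩ := hsep y x h.symm
  refine ⟨a / b, ?_, ?_⟩
  · rw [map_div₀, div_lt_one₀ (zero_lt_one.trans hb2)]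
    exact ha1.trans_lt hb2
  · have hb0 : b ≠ 0 := by rintro rfl; simp at hb2
    rw [map_div₀, one_lt_div₀ ((Valuation.pos_iff _).2 hb0)]
    exact hb1.trans_lt ha2

lemma sep_many (hsep : ∀ x y, x ≠ y → ∃ a, v x a ≤ 1 ∧ 1 < v y a) (x : I) (S : Finset I)
    (hx : x ∉ S) : ∃ z, v x z < 1 ∧ ∀ y ∈ S, 1 < v y z := by
  classical
  induction S using Finset.induction_on with
  | empty => exact ⟨0, by simp, by simp⟩
  | insert y S hy ih =>
    obtain ⟨z, hz1, hz2⟩ := ih (fun h => hx (by simp [h]))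
    by_cases hyz : 1 < v y z
    · refine ⟨z, hz1, ?_⟩
      intro s hs
      rcases Finset.mem_insert.1 hs with rfl | hs
      · exact hyz
      · exact hz2 s hs
    push Not at hyz
    obtain ⟨w, hw1, hw2⟩ := sep_two v hsep x y (fun h => hx (by simp [h]))
    have hev : ∀ᶠ r : ℕ in atTop, ∀ s ∈ S, v s z ≠ v s (w ^ r) := by
      rw [Filter.eventually_all_finset]
      intro s hs
      have h1 := hz2 s hs
      by_cases h2 : v s w ≤ 1
      · refine Eventually.of_forall fun r => ?_
        rw [map_pow]
        exact ((pow_le_one' h2 r).trans_lt h1).ne'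
      · push Not at h2
        obtain ⟨n, hn⟩ := MulArchimedean.arch (v s z) h2
        filter_upwards [eventually_gt_atTop n] with r hr
        rw [map_pow]
        exact (hn.trans_lt (pow_lt_pow_right₀ h2 hr)).ne
    obtain ⟨r, hr, hr1⟩ := (hev.and (eventually_ge_atTop 1)).exists
    have hr0 : r ≠ 0 := by omega
    refine ⟨z + w ^ r, ?_, ?_⟩
    · refine (Valuation.map_add _ _ _).trans_lt (max_lt hz1 ?_)
      rw [map_pow]
      exact pow_lt_one' hw1 hr0
    · intro s hs
      rcases Finset.mem_insert.1 hs with rfl | hs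
      · have : 1 < v s (w ^ r) := by rw [map_pow]; exact one_lt_pow' hw2 hr0
        rw [Valuation.map_add_eq_of_lt_right _ (hyz.trans_lt this)]
        exact this
      · rw [Valuation.map_add_of_distinct_val _ (hr s hs)]
        exact lt_max_of_lt_left (hz2 s hs)

lemma eventually_pow_le (a ε : WithZero (Multiplicative ℤ)) (ha : a < 1) (hε : ε ≠ 0) :
    ∀ᶠ n : ℕ in atTop, a ^ n ≤ ε := by
  obtain ⟨n, hn⟩ := exists_pow_lt₀ ha (Units.mk0 ε hε)
  filter_upwards [eventually_ge_atTop n] with m hm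
  exact (pow_le_pow_right_of_le_one' ha.le hm).trans hn.le

lemma exists_idem (hsep : ∀ x y, x ≠ y → ∃ a, v x a ≤ 1 ∧ 1 < v y a) (x : I) (S : Finset I)
    (hx : x ∉ S) (ε : WithZero (Multiplicative ℤ)) (hε : ε ≠ 0) :
    ∃ e, v x (e - 1) ≤ ε ∧ ∀ y ∈ S, v y e ≤ ε := by
  obtain ⟨z, hz1, hz2⟩ := sep_many v hsep x S hx
  have h2 : ∀ᶠ n : ℕ in atTop, ∀ y ∈ S, (v y z)⁻¹ ^ n ≤ ε := by
    rw [Filter.eventually_all_finset]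
    intro y hy
    exact eventually_pow_le _ _ (inv_lt_one_of_one_lt₀ (hz2 y hy)) hε
  obtain ⟨n, ⟨hn1, hn2⟩, hn3⟩ := (((eventually_pow_le _ _ hz1 hε).and h2).and
    (eventually_ge_atTop 1)).exists
  have hn0 : n ≠ 0 := by omega
  have hvx : v x (z ^ n) < 1 := by rw [map_pow]; exact pow_lt_one' hz1 hn0
  have hOne : v x (1 + z ^ n) = 1 := Valuation.map_one_add_of_lt _ hvx
  have hne : 1 + z ^ n ≠ 0 := by
    intro h
    rw [h] at hOne
    simp at hOne
  refine ⟨(1 + z ^ n)⁻¹, ?_, ?_⟩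
  · have : (1 + z ^ n)⁻¹ - 1 = - (z ^ n) * (1 + z ^ n)⁻¹ := by
      field_simp; ring
    rw [this, map_mul, map_inv₀, hOne, Valuation.map_neg, map_pow]
    simpa using hn1
  · intro y hy
    have h1 : v y 1 < v y (z ^ n) := by
      rw [map_pow, map_one]
      exact one_lt_pow' (hz2 y hy) hn0
    rw [map_inv₀, Valuation.map_add_eq_of_lt_right _ h1, map_pow, ← inv_pow]
    exact hn2 y hy

lemma exists_idem_many [DecidableEq I]
    (hsep : ∀ x y, x ≠ y → ∃ a, v x a ≤ 1 ∧ 1 < v y a) (S : Finset I)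
    (ε : WithZero (Multiplicative ℤ)) (hε : ε ≠ 0) :
    ∃ e : I → k, ∀ x ∈ S, v x (e x - 1) ≤ ε ∧ ∀ y ∈ S, y ≠ x → v y (e x) ≤ ε := by
  have : ∀ x, ∃ e, v x (e - 1) ≤ ε ∧ ∀ y ∈ S.erase x, v y e ≤ ε := fun x =>
    exists_idem v hsep x (S.erase x) (by simp) ε hε
  choose e he using this
  exact ⟨e, fun x _ => ⟨(he x).1, fun y hy hyx => (he x).2 y (by simp [hy, hyx])⟩⟩

/-- weak approximation -/
lemma weak_approx (hsep : ∀ x y, x ≠ y → ∃ a, v x a ≤ 1 ∧ 1 < v y a) (S : Finset I)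
    (b : I → k) : ∃ a, ∀ x ∈ S, v x (a - b x) ≤ 1 := by
  classical
  -- choose ε small
  have hε : ∃ ε : WithZero (Multiplicative ℤ), ε ≠ 0 ∧ ∀ x ∈ S, ∀ y ∈ S, v x (b y) * ε ≤ 1 := by
    have : ∀ᶠ n : ℕ in atTop, ∀ x ∈ S, ∀ y ∈ S, v x (b y) * (exp (-1 : ℤ)) ^ n ≤ 1 := by
      rw [Filter.eventually_all_finset]
      intro x hx
      rw [Filter.eventually_all_finset]
      intro y hy
      by_cases h0 : v x (b y) = 0
      · simp [h0]
      filter_upwards [eventually_pow_le (exp (-1 : ℤ)) (v x (b y))⁻¹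
        (by rw [← exp_zero, exp_lt_exp]; norm_num) (inv_ne_zero h0)] with n hn
      calc _ ≤ v x (b y) * (v x (b y))⁻¹ := by gcongr
        _ = 1 := mul_inv_cancel₀ h0
    obtain ⟨n, hn⟩ := this.exists
    exact ⟨_, pow_ne_zero _ (by simp), hn⟩
  obtain ⟨ε, hε0, hε⟩ := hε
  obtain ⟨e, he⟩ := exists_idem_many v hsep S ε hε0
  refine ⟨∑ y ∈ S, b y * e y, fun x hx => ?_⟩
  have : ∑ y ∈ S, b y * e y - b x = ∑ y ∈ S, b y * (e y - if y = x then 1 else 0) := by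
    simp [mul_sub, Finset.sum_sub_distrib, hx]
  rw [this]
  refine Valuation.map_sum_le _ fun y hy => ?_
  rw [map_mul]
  refine le_trans ?_ (hε x hx y hy)
  gcongr
  split_ifs with h
  · subst h; exact (he y hy).1
  · rw [sub_zero]
    exact (he y hy).2 x hx (Ne.symm h)

end WA

end ResThm


namespace ResThm

section Alg

open Polynomial IntermediateField

variable {F k : Type} [Field F] [Field k] [Algebra F k]

lemma finite_of_transcendental (hfg : ∃ t : k, ¬ IsAlgebraic F t ∧
      FiniteDimensional (IntermediateField.adjoin F ({t} : Set k)) k)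
    (u : k) (hu : ¬ IsAlgebraic F u) :
    FiniteDimensional (IntermediateField.adjoin F ({u} : Set k)) k := by
  obtain ⟨t, ht, hfin⟩ := hfg
  have e1 : Algebra.EssFiniteType F (IntermediateField.adjoin F ({t} : Set k)) := by
    rw [IntermediateField.essFiniteType_iff]
    exact ⟨{t}, by simp⟩
  have e2 : Algebra.EssFiniteType F k :=
    Algebra.EssFiniteType.comp F (IntermediateField.adjoin F ({t} : Set k)) k
  have e3 : Algebra.EssFiniteType (IntermediateField.adjoin F ({u} : Set k)) k :=
    Algebra.EssFiniteType.of_comp F _ k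
  have ht1 : AlgebraicIndependent F (fun _ : Unit => t) := by
    rw [algebraicIndependent_unique_type_iff]; exact ht
  have hu1 : AlgebraicIndependent F (fun _ : Unit => u) := by
    rw [algebraicIndependent_unique_type_iff]; exact hu
  have hr : Set.range (fun _ : Unit => t) = {t} := by simp
  have hru : Set.range (fun _ : Unit => u) = {u} := by simp
  have htb : IsTranscendenceBasis F (fun _ : Unit => t) := by
    rw [ht1.isTranscendenceBasis_iff_isAlgebraic]
    have : Algebra.IsAlgebraic (IntermediateField.adjoin F (Set.range (fun _ : Unit => t))) k := by
      rw [hr]; infer_instance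
    exact ⟨fun z => IntermediateField.isAlgebraic_adjoin_iff.1 (this.isAlgebraic z)⟩
  have hub : IsTranscendenceBasis F (fun _ : Unit => u) := by
    apply hu1.isTranscendenceBasis_of_trdeg_le
    · rw [← htb.cardinalMk_eq_trdeg]; simp
    · rw [← htb.cardinalMk_eq_trdeg]
  have : Algebra.IsAlgebraic (IntermediateField.adjoin F (Set.range (fun _ : Unit => u))) k :=
    hub.isAlgebraic_field
  rw [hru] at this
  exact Algebra.finite_of_essFiniteType_of_isAlgebraic

lemma aeval_ne_zero_of (t : k) (ht : ¬ IsAlgebraic F t) (p : F[X]) (hp : p ≠ 0) :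
    aeval t p ≠ 0 := fun h => ht ⟨p, hp, h⟩

lemma common_denom (t : k) (ht : ¬ IsAlgebraic F t) {ι : Type} (s : Finset ι)
    (r : ι → IntermediateField.adjoin F ({t} : Set k)) :
    ∃ Q : F[X], Q ≠ 0 ∧ ∃ c : ι → F[X], ∀ i ∈ s, aeval t Q * (r i : k) = aeval t (c i) := by
  classical
  have h : ∀ i, ∃ p q : F[X], q ≠ 0 ∧ aeval t q * (r i : k) = aeval t p := by
    intro i
    obtain ⟨p, q, hpq⟩ := (IntermediateField.mem_adjoin_simple_iff F (r i : k)).1 (r i).2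
    by_cases hq : q = 0
    · subst hq
      exact ⟨0, 1, one_ne_zero, by simp [hpq]⟩
    · refine ⟨p, q, hq, ?_⟩
      rw [hpq, mul_div_cancel₀ _ (aeval_ne_zero_of t ht q hq)]
  choose p q hq hpq using h
  refine ⟨∏ i ∈ s, q i, Finset.prod_ne_zero_iff.2 fun i _ => hq i,
    fun i => p i * ∏ j ∈ s.erase i, q j, fun i hi => ?_⟩
  rw [← Finset.mul_prod_erase s q hi, map_mul, map_mul, ← hpq]
  ring

variable {I : Type} (v : I → Valuation k (WithZero (Multiplicative ℤ)))

/-- Properties of the family of places used below. -/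
structure Places (F : Type) {k : Type} [Field F] [Field k] [Algebra F k] {I : Type}
    (v : I → Valuation k (WithZero (Multiplicative ℤ))) : Prop where
  sep : ∀ x y, x ≠ y → ∃ a, v x a ≤ 1 ∧ 1 < v y a
  triv : ∀ x (c : F), c ≠ 0 → v x (algebraMap F k c) = 1
  res : ∀ x a, v x a ≤ 1 → ∃ p : F[X], Irreducible p ∧ v x (aeval a p) < 1
  fin : ∀ u : k, ¬ IsAlgebraic F u →
    FiniteDimensional (IntermediateField.adjoin F ({u} : Set k)) k
  const : ∀ a : k, IsAlgebraic F a → a ∈ (algebraMap F k).range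

lemma mul_lt_one_A {a b : WithZero (Multiplicative ℤ)} (ha : a < 1) (hb : b ≤ 1) : a * b < 1 :=
  (mul_le_of_le_one_right' hb).trans_lt ha

lemma mul_lt_one_B {a b : WithZero (Multiplicative ℤ)} (ha : a ≤ 1) (hb : b < 1) : a * b < 1 :=
  (mul_le_of_le_one_left' ha).trans_lt hb

variable {v}

lemma Places.triv_le (H : Places F v) (x : I) (c : F) : v x (algebraMap F k c) ≤ 1 := by
  by_cases hc : c = 0
  · simp [hc]
  · exact (H.triv x c hc).le

lemma Places.aeval_le (H : Places F v) (x : I) (a : k) (ha : v x a ≤ 1) (p : F[X]) : v x (aeval a p) ≤ 1 := by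
  rw [aeval_eq_sum_range]
  refine Valuation.map_sum_le _ fun i _ => ?_
  rw [Algebra.smul_def, map_mul, map_pow]
  exact mul_le_one' (H.triv_le x _) (pow_le_one' ha i)

lemma Places.aeval_eq (H : Places F v) (x : I) (a : k) (ha : 1 < v x a) (p : F[X]) (hp : p ≠ 0) :
    v x (aeval a p) = v x a ^ p.natDegree := by
  have hlead : v x (p.coeff p.natDegree • a ^ p.natDegree) = v x a ^ p.natDegree := by
    rw [Algebra.smul_def, map_mul, map_pow, H.triv x _ (by simpa using hp), one_mul]
  rw [aeval_eq_sum_range, Finset.sum_range_succ, Valuation.map_add_eq_of_lt_right, hlead]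
  rw [hlead]
  refine Valuation.map_sum_lt _ (pow_ne_zero _ (zero_lt_one.trans ha).ne') fun i hi => ?_
  rw [Finset.mem_range] at hi
  rw [Algebra.smul_def, map_mul, map_pow]
  calc _ ≤ 1 * v x a ^ i := by gcongr; exact H.triv_le x _
    _ < _ := by rw [one_mul]; exact pow_lt_pow_right₀ ha hi

lemma Places.poly_indep (H : Places F v) (u : k) (hu : u ≠ 0) (S : Finset I) (hS : ∀ x ∈ S, v x u < 1)
    (e : I → k) (he : ∀ x ∈ S, v x (e x - 1) < 1 ∧ ∀ y ∈ S, y ≠ x → v y (e x) < 1) (n : ℕ) :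
    ∀ c : I → F[X], ∑ x ∈ S, aeval u (c x) * e x = 0 → ∀ x ∈ S, (c x).coeff n = 0 := by
  classical
  have step : ∀ c : I → F[X], ∑ x ∈ S, aeval u (c x) * e x = 0 → ∀ x ∈ S, (c x).coeff 0 = 0 := by
    intro c hc x hx
    by_contra h0
    have h1 : v x (algebraMap F k ((c x).coeff 0)) = 1 := H.triv x _ h0
    have hle : ∀ p : F[X], v x (aeval u p) ≤ 1 := H.aeval_le x u (hS x hx).le
    have h2 : algebraMap F k ((c x).coeff 0) =
        - (u * aeval u (divX (c x))) - aeval u (c x) * (e x - 1)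
          - ∑ y ∈ S.erase x, aeval u (c y) * e y := by
      rw [← Finset.add_sum_erase S _ hx] at hc
      have h3 : aeval u (c x) = u * aeval u (divX (c x)) + algebraMap F k ((c x).coeff 0) := by
        have h5 := congrArg (aeval u) (X_mul_divX_add (c x)).symm
        simpa only [map_add, map_mul, aeval_X, aeval_C] using h5
      linear_combination hc - h3
    have h4 : v x (algebraMap F k ((c x).coeff 0)) < 1 := by
      rw [h2]
      refine Valuation.map_sub_lt _ (Valuation.map_sub_lt _ ?_ ?_) ?_
      · rw [Valuation.map_neg, map_mul]
        exact mul_lt_one_A (hS x hx) (hle _)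
      · rw [map_mul]
        exact mul_lt_one_B (hle _) (he x hx).1
      · refine Valuation.map_sum_lt _ one_ne_zero fun y hy => ?_
        rw [Finset.mem_erase] at hy
        rw [map_mul]
        exact mul_lt_one_B (hle _) ((he y hy.2).2 x hx hy.1.symm)
    exact h4.ne h1
  induction n with
  | zero => exact step
  | succ n ih =>
    intro c hc x hx
    have h0 := step c hc
    rw [← coeff_divX]
    refine ih (fun x => divX (c x)) ?_ x hx
    apply mul_left_cancel₀ hu
    rw [mul_zero, ← hc, Finset.mul_sum]
    refine Finset.sum_congr rfl fun y hy => ?_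
    have h3 : aeval u (c y) = u * aeval u (divX (c y)) + algebraMap F k ((c y).coeff 0) := by
      have h5 := congrArg (aeval u) (X_mul_divX_add (c y)).symm
      simpa only [map_add, map_mul, aeval_X, aeval_C] using h5
    rw [h3, h0 y hy]
    simp [mul_assoc]

lemma Places.finite_poles (H : Places F v) (a : k) : {x | 1 < v x a}.Finite := by
  classical
  by_cases ha : IsAlgebraic F a
  · obtain ⟨c, rfl⟩ := H.const a ha
    convert Set.finite_empty
    ext x
    simpa using H.triv_le x c
  have ha0 : a ≠ 0 := by rintro rfl; exact ha isAlgebraic_zero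
  have hu : ¬ IsAlgebraic F a⁻¹ := fun h => ha (by simpa using h.inv)
  have hfin := H.fin a⁻¹ hu
  by_contra hinf
  obtain ⟨S, hS, hcard⟩ := Set.Infinite.exists_subset_card_eq hinf
    (Module.finrank (IntermediateField.adjoin F ({a⁻¹} : Set k)) k + 1)
  have hS' : ∀ x ∈ S, v x a⁻¹ < 1 := by
    intro x hx
    rw [map_inv₀]
    exact inv_lt_one_of_one_lt₀ (hS hx)
  have hε : (WithZero.exp (-1 : ℤ)) < 1 := by
    rw [← WithZero.exp_zero, WithZero.exp_lt_exp]; norm_num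
  obtain ⟨e, he⟩ := exists_idem_many v H.sep S (WithZero.exp (-1 : ℤ)) (by simp)
  have hnl : ¬ LinearIndepOn (IntermediateField.adjoin F ({a⁻¹} : Set k)) e (S : Set I) := by
    intro hl
    have := hl.encard_le_toENat_rank
    rw [← Module.finrank_eq_rank, map_natCast, Set.encard_coe_eq_coe_finsetCard, hcard] at this
    norm_cast at this
    omega
  rw [linearIndepOn_finset_iff] at hnl
  push Not at hnl
  obtain ⟨r, hr, x, hx, hrx⟩ := hnl
  obtain ⟨Q, hQ, c, hc⟩ := common_denom a⁻¹ hu S r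
  have hsum : ∑ x ∈ S, aeval a⁻¹ (c x) * e x = 0 := by
    rw [← mul_zero (aeval a⁻¹ Q), ← hr, Finset.mul_sum]
    refine Finset.sum_congr rfl fun y hy => ?_
    rw [← hc y hy, mul_assoc]
    rfl
  have hcx : c x = 0 := by
    ext n
    exact H.poly_indep a⁻¹ (inv_ne_zero ha0) S hS' e
      (fun x hx => ⟨(he x hx).1.trans_lt hε, fun y hy hyx => ((he x hx).2 y hy hyx).trans_lt hε⟩)
      n c hsum x hx
  have := hc x hx
  rw [hcx, map_zero, mul_eq_zero] at this
  rcases this with h | h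
  · exact aeval_ne_zero_of _ hu Q hQ h
  · exact hrx (by exact_mod_cast h)

end Alg

end ResThm


namespace ResThm

section SA

open Polynomial IntermediateField

variable {F k : Type} [Field F] [Field k] [Algebra F k]
variable {I : Type} {v : I → Valuation k (WithZero (Multiplicative ℤ))}

lemma Places.denom (H : Places F v) (t : k) (D : F[X]) (a : k) (P : Finset I)
    (hP : ∀ x ∈ P, v x t ≤ 1 ∧ ¬ v x (aeval t D) < 1) :
    ∃ E : F[X], E ≠ 0 ∧ IsCoprime E D ∧ ∀ x ∈ P, v x (aeval t E * a) ≤ 1 := by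
  classical
  induction P using Finset.induction_on with
  | empty => exact ⟨1, one_ne_zero, isCoprime_one_left, by simp⟩
  | insert x P hx ih =>
    obtain ⟨E, hE0, hED, hE⟩ := ih fun y hy => hP y (Finset.mem_insert_of_mem hy)
    obtain ⟨hxt, hxD⟩ := hP x (Finset.mem_insert_self _ _)
    obtain ⟨p, hp, hpx⟩ := H.res x t hxt
    have hcop : IsCoprime p D := by
      by_contra h
      rw [hp.coprime_iff_not_dvd, not_not] at h
      obtain ⟨q, rfl⟩ := h
      · refine absurd ?_ hxD
        rw [map_mul, map_mul]
        exact mul_lt_one_A hpx (H.aeval_le x t hxt q)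
    obtain ⟨n, hn⟩ : ∃ n : ℕ, v x (aeval t p) ^ n * v x (aeval t E * a) ≤ 1 := by
      by_cases h0 : v x (aeval t E * a) = 0
      · exact ⟨0, by simp [h0]⟩
      obtain ⟨n, hn⟩ := (eventually_pow_le _ (v x (aeval t E * a))⁻¹ hpx
        (inv_ne_zero h0)).exists
      refine ⟨n, (mul_le_mul_left hn _).trans ?_⟩
      rw [inv_mul_cancel₀ h0]
    refine ⟨p ^ n * E, mul_ne_zero (pow_ne_zero _ hp.ne_zero) hE0, (hcop.pow_left).mul_left hED, ?_⟩
    intro y hy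
    rcases Finset.mem_insert.1 hy with rfl | hy'
    · rw [map_mul (aeval t), mul_assoc, map_mul, map_pow, map_pow]
      exact hn
    · rw [map_mul (aeval t), mul_assoc, map_mul]
      exact mul_le_one' (H.aeval_le y t (hP y hy).1 _) (hE y hy')

lemma Places.denom' (H : Places F v) (t : k) (a : k) :
    ∃ E : F[X], E ≠ 0 ∧ ∀ x, v x t ≤ 1 → v x (aeval t E * a) ≤ 1 := by
  classical
  obtain ⟨E, hE0, -, hE⟩ := H.denom t 1 a ((H.finite_poles a).toFinset.filter fun x => v x t ≤ 1)
    (by intro x hx; exact ⟨(Finset.mem_filter.1 hx).2, by simp⟩)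
  refine ⟨E, hE0, fun x hx => ?_⟩
  by_cases h : 1 < v x a
  · exact hE x (by simp [h, hx])
  · push Not at h
    rw [map_mul]
    exact mul_le_one' (H.aeval_le x t hx _) h

lemma Places.strong (H : Places F v) (t : k) (ht : ¬ IsAlgebraic F t) (S : Finset I) (b : I → k) :
    ∃ a, ∀ x, v x t ≤ 1 → (x ∈ S → v x (a - b x) ≤ 1) ∧ (x ∉ S → v x a ≤ 1) := by
  classical
  choose d hd0 hd using fun x => H.denom' t (b x)
  set D := ∏ x ∈ S, d x with hD
  have hD0 : D ≠ 0 := Finset.prod_ne_zero_iff.2 fun x _ => hd0 x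
  have hDb : ∀ x ∈ S, v x t ≤ 1 → v x (aeval t D * b x) ≤ 1 := by
    intro x hx hxt
    rw [hD, ← Finset.prod_erase_mul S d hx, map_mul (aeval t), mul_assoc, map_mul]
    exact mul_le_one' (H.aeval_le x t hxt _) (hd x x hxt)
  have hDt : aeval t D ≠ 0 := aeval_ne_zero_of t ht D hD0
  set T := (H.finite_poles (aeval t D)⁻¹).toFinset with hT
  obtain ⟨a0, ha0⟩ := weak_approx v H.sep (S ∪ T) (fun x => if x ∈ S then b x else 0)
  obtain ⟨E, hE0, ⟨u, w, huw⟩, hE⟩ := H.denom t D a0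
    ((H.finite_poles a0).toFinset.filter fun x => v x t ≤ 1 ∧ x ∉ T) (by
      intro x hx
      obtain ⟨-, h1, h2⟩ := Finset.mem_filter.1 hx
      refine ⟨h1, fun h => h2 ?_⟩
      simp only [hT, Set.Finite.mem_toFinset, Set.mem_ofPred_eq, map_inv₀]
      rw [one_lt_inv₀ ((Valuation.pos_iff _).2 hDt)]
      exact h)
  have huw' : aeval t u * aeval t E + aeval t w * aeval t D = 1 := by
    rw [← map_mul, ← map_mul, ← map_add, huw, map_one]
  refine ⟨aeval t u * aeval t E * a0, fun x hxt => ⟨fun hxS => ?_, fun hxS => ?_⟩⟩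
  · have : aeval t u * aeval t E * a0 - b x =
        aeval t (u * E) * (a0 - b x) - aeval t w * (aeval t D * b x) := by
      rw [map_mul]
      linear_combination (b x) * huw'
    rw [this]
    have h1 := ha0 x (Finset.mem_union_left _ hxS)
    rw [if_pos hxS] at h1
    refine (Valuation.map_sub _ _ _).trans (max_le ?_ ?_)
    · rw [map_mul]
      exact mul_le_one' (H.aeval_le x t hxt _) h1
    · rw [map_mul]
      exact mul_le_one' (H.aeval_le x t hxt _) (hDb x hxS hxt)
  · by_cases hreg : v x a0 ≤ 1
    · rw [← map_mul, map_mul]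
      exact mul_le_one' (H.aeval_le x t hxt _) hreg
    · have hxT : x ∉ T := by
        intro hxT
        have := ha0 x (Finset.mem_union_right _ hxT)
        rw [if_neg hxS, sub_zero] at this
        exact hreg this
      rw [mul_assoc, map_mul]
      push Not at hreg
      exact mul_le_one' (H.aeval_le x t hxt _) (hE x (by simp [hreg, hxt, hxT]))

lemma Places.split_one (H : Places F v) (t : k) (ht : ¬ IsAlgebraic F t) (e : k)
    (he : ∀ x, v x t ≤ 1 → v x e ≤ 1) (N : ℕ) (hN0 : 0 < N)
    (hN : ∀ x, 1 < v x t → v x ((t ^ N)⁻¹ * e) ≤ 1) (p q : F[X]) (hq : q ≠ 0) :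
    ∃ a1 a2, ∃ a3 ∈ Submodule.span F (Set.range fun j : Fin N => (t ^ N)⁻¹ * t ^ (j : ℕ) * e),
      aeval t p / aeval t q * e = a1 + a2 + a3 ∧ (∀ x, v x t ≤ 1 → v x a1 ≤ 1) ∧
        (∀ x, 1 < v x t → v x a2 ≤ 1) := by
  have ht0 : t ≠ 0 := by rintro rfl; exact ht isAlgebraic_zero
  have hqt := aeval_ne_zero_of t ht q hq
  set s := (X ^ N * p) / q with hs
  set m := (X ^ N * p) % q with hm
  have h1 : q * s + m = X ^ N * p := EuclideanDomain.div_add_mod _ _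
  have h2 : s %ₘ X ^ N + X ^ N * (s /ₘ X ^ N) = s := modByMonic_add_div s (X ^ N)
  set l := s %ₘ X ^ N with hl
  set r := s /ₘ X ^ N with hr
  have hld : l.natDegree < N := by
    have := natDegree_modByMonic_lt s (monic_X_pow (R := F) N)
      (by intro h; have := congrArg natDegree h; simp at this; omega)
    simpa using this
  have h1' := congrArg (aeval t) h1
  have h2' := congrArg (aeval t) h2
  simp only [map_add, map_mul, map_pow, aeval_X] at h1' h2'
  refine ⟨aeval t r * e, aeval t m / aeval t q * ((t ^ N)⁻¹ * e), (t ^ N)⁻¹ * aeval t l * e,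
    ?_, ?_, ?_, ?_⟩
  · rw [aeval_eq_sum_range' hld, Finset.mul_sum, Finset.sum_mul]
    refine Submodule.sum_mem _ fun j hj => ?_
    have : (t ^ N)⁻¹ * l.coeff j • t ^ j * e = l.coeff j • ((t ^ N)⁻¹ * t ^ j * e) := by
      rw [mul_smul_comm, smul_mul_assoc]
    rw [this]
    exact Submodule.smul_mem _ _ (Submodule.subset_span ⟨⟨j, Finset.mem_range.1 hj⟩, rfl⟩)
  · field_simp
    linear_combination (-e) * h1' - (e * aeval t q) * h2'
  · intro x hx
    rw [map_mul]
    exact mul_le_one' (H.aeval_le x t hx _) (he x hx)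
  · intro x hx
    rw [map_mul]
    refine mul_le_one' ?_ (hN x hx)
    rw [map_div₀]
    by_cases hm0 : m = 0
    · simp [hm0]
    rw [div_le_one₀ ((Valuation.pos_iff _).2 hqt), H.aeval_eq x t hx _ hq, H.aeval_eq x t hx _ hm0]
    exact pow_le_pow_right₀ hx.le (natDegree_le_natDegree (EuclideanDomain.mod_lt _ hq).le)

lemma Places.split (H : Places F v) (t : k) (ht : ¬ IsAlgebraic F t) :
    ∃ U : Submodule F k, FiniteDimensional F U ∧ ∀ c, ∃ a1 a2, ∃ a3 ∈ U,
      c = a1 + a2 + a3 ∧ (∀ x, v x t ≤ 1 → v x a1 ≤ 1) ∧ (∀ x, 1 < v x t → v x a2 ≤ 1) := by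
  classical
  have hfin := H.fin t ht
  have ht0 : t ≠ 0 := by rintro rfl; exact ht isAlgebraic_zero
  set B := Module.finBasis (IntermediateField.adjoin F ({t} : Set k)) k with hB
  choose d hd0 hd using fun i => H.denom' t (B i)
  have hN : ∀ᶠ N : ℕ in Filter.atTop, ∀ x ∈ (H.finite_poles t).toFinset, ∀ i,
      v x ((t ^ N)⁻¹ * (aeval t (d i) * B i)) ≤ 1 := by
    rw [Filter.eventually_all_finset]
    intro x hx
    rw [Filter.eventually_all]
    intro i
    have hx' : 1 < v x t := by simpa using hx
    have hne : v x (aeval t (d i) * B i) ≠ 0 := by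
      rw [Valuation.ne_zero_iff]
      exact mul_ne_zero (aeval_ne_zero_of t ht _ (hd0 i)) (B.ne_zero i)
    filter_upwards [eventually_pow_le (v x t)⁻¹ (v x (aeval t (d i) * B i))⁻¹
      (inv_lt_one_of_one_lt₀ hx') (inv_ne_zero hne)] with n hn
    rw [map_mul, map_inv₀, map_pow, ← inv_pow]
    refine (mul_le_mul_left hn _).trans ?_
    rw [inv_mul_cancel₀ hne]
  obtain ⟨N, hN, hN0⟩ := (hN.and (Filter.eventually_gt_atTop 0)).exists
  refine ⟨⨆ i, Submodule.span F
    (Set.range fun j : Fin N => (t ^ N)⁻¹ * t ^ (j : ℕ) * (aeval t (d i) * B i)), ?_, ?_⟩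
  · have : ∀ i, FiniteDimensional F (Submodule.span F
      (Set.range fun j : Fin N => (t ^ N)⁻¹ * t ^ (j : ℕ) * (aeval t (d i) * B i))) :=
      fun i => FiniteDimensional.span_of_finite F (Set.finite_range _)
    exact Submodule.finiteDimensional_iSup _
  intro c
  have key : ∀ i, ∃ a1 a2, ∃ a3 ∈ Submodule.span F
      (Set.range fun j : Fin N => (t ^ N)⁻¹ * t ^ (j : ℕ) * (aeval t (d i) * B i)),
      B.repr c i • B i = a1 + a2 + a3 ∧ (∀ x, v x t ≤ 1 → v x a1 ≤ 1) ∧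
        (∀ x, 1 < v x t → v x a2 ≤ 1) := by
    intro i
    obtain ⟨Q, hQ, p, hp⟩ := common_denom t ht {()} (fun _ => B.repr c i)
    have hp' := hp () (by simp)
    have hQt := aeval_ne_zero_of t ht Q hQ
    have hdt := aeval_ne_zero_of t ht _ (hd0 i)
    obtain ⟨a1, a2, a3, h3, h, h'⟩ := H.split_one t ht (aeval t (d i) * B i) (hd i) N hN0
      (fun x hx => hN x (by simpa using hx) i) (p ()) (Q * d i) (mul_ne_zero hQ (hd0 i))
    refine ⟨a1, a2, a3, h3, ?_, h'⟩
    rw [← h, ← hp', map_mul, IntermediateField.smul_def, smul_eq_mul]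
    field_simp
  choose a1 a2 a3 h3 hs h1 h2 using key
  refine ⟨∑ i, a1 i, ∑ i, a2 i, ∑ i, a3 i, ?_, ?_, ?_, ?_⟩
  · exact Submodule.sum_mem _ fun i _ => Submodule.mem_iSup_of_mem i (h3 i)
  · rw [← Finset.sum_add_distrib, ← Finset.sum_add_distrib]
    refine (B.sum_repr c).symm.trans (Finset.sum_congr rfl fun i _ => hs i)
  · exact fun x hx => Valuation.map_sum_le _ fun i _ => h1 i x hx
  · exact fun x hx => Valuation.map_sum_le _ fun i _ => h2 i x hx

end SA

end ResThm


namespace ResThm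

section PL

open Polynomial IntermediateField

variable {F k : Type} [Field F] [Field k] [Algebra F k] {I : Type}
  {κ : I → Type} [∀ x, Field (κ x)] [∀ x, Algebra F (κ x)] (ι : ∀ x, k →ₐ[F] LaurentSeries (κ x))

/-- the valuation of `k` attached to `x` -/
noncomputable def pval (x : I) : Valuation k (WithZero (Multiplicative ℤ)) :=
  (Valued.v : Valuation (LaurentSeries (κ x)) (WithZero (Multiplicative ℤ))).comap
    (ι x).toRingHom

lemma pval_le_one_iff (x : I) (a : k) :
    pval ι x a ≤ 1 ↔ ∀ n < 0, (ι x a).coeff n = 0 := by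
  have := LaurentSeries.valuation_le_iff_coeff_lt_eq_zero (K := κ x) (D := 0) (f := ι x a)
  rw [neg_zero, WithZero.exp_zero] at this
  exact this

lemma pval_le_one_iff' (x : I) (a : k) :
    pval ι x a ≤ 1 ↔ ∃ g : PowerSeries (κ x), (ι x) a = HahnSeries.ofPowerSeries ℤ (κ x) g := by
  have := LaurentSeries.val_le_one_iff_eq_coe (K := κ x) (ι x a)
  exact this.trans ⟨fun ⟨g, hg⟩ => ⟨g, hg.symm⟩, fun ⟨g, hg⟩ => ⟨g, hg.symm⟩⟩

lemma pval_lt_one (x : I) (a : k) (h : ∀ n < 1, (ι x a).coeff n = 0) : pval ι x a < 1 := by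
  have := (LaurentSeries.valuation_le_iff_coeff_lt_eq_zero (K := κ x) (D := 1) (f := ι x a)).2 h
  refine lt_of_le_of_lt this ?_
  rw [← WithZero.exp_zero, WithZero.exp_lt_exp]; norm_num

lemma ι_const (x : I) (c : F) : ι x (algebraMap F k c) =
    HahnSeries.ofPowerSeries ℤ (κ x) (algebraMap F (PowerSeries (κ x)) c) := by
  rw [AlgHom.commutes]
  rfl

lemma ι_const' (x : I) (c : F) : ι x (algebraMap F k c) =
    HahnSeries.C (algebraMap F (κ x) c) := by
  rw [ι_const, PowerSeries.algebraMap_apply]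
  simp

lemma ι_smul (x : I) (c : F) (a : k) : ι x (c • a) =
    HahnSeries.C (algebraMap F (κ x) c) * ι x a := by
  rw [Algebra.smul_def, map_mul, ι_const']

lemma exists_pole (hdense : ∀ (x : I) (f : LaurentSeries (κ x)) (N : ℤ),
      ∃ a : k, ∀ m ≤ N, ((ι x) a - f).coeff m = 0) (x : I) : ∃ c, 1 < pval ι x c := by
  obtain ⟨c, hc⟩ := hdense x (HahnSeries.single (-1) 1) (-1)
  refine ⟨c, ?_⟩
  by_contra h
  push Not at h
  rw [pval_le_one_iff] at h
  have := hc (-1) le_rfl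
  rw [HahnSeries.coeff_sub, h (-1) (by norm_num)] at this
  simp at this

lemma places
    (hfg : ∃ t : k, ¬ IsAlgebraic F t ∧
      FiniteDimensional (IntermediateField.adjoin F ({t} : Set k)) k)
    (hgc : ∀ a : k, IsAlgebraic F a → a ∈ (algebraMap F k).range)
    [∀ x, FiniteDimensional F (κ x)]
    (hdense : ∀ (x : I) (f : LaurentSeries (κ x)) (N : ℤ),
      ∃ a : k, ∀ m ≤ N, ((ι x) a - f).coeff m = 0)
    (hplaces : ∀ O : ValuationSubring k,
      (∀ c : F, algebraMap F k c ∈ O) → (O : Set k) ≠ Set.univ →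
      ∃! x : I, ∀ a : k,
        a ∈ O ↔ ∃ g : PowerSeries (κ x), (ι x) a = HahnSeries.ofPowerSeries ℤ (κ x) g) :
    Places F (pval ι) := by
  have hc : ∀ x (c : F), pval ι x (algebraMap F k c) ≤ 1 := by
    intro x c
    rw [pval_le_one_iff']
    exact ⟨_, ι_const ι x c⟩
  refine ⟨?_, ?_, ?_, finite_of_transcendental hfg, hgc⟩
  · intro x y hxy
    by_contra! hsub
    obtain ⟨z, hz, huniq⟩ := hplaces (pval ι x).valuationSubring (hc x) (by
      intro h
      obtain ⟨c, hc⟩ := exists_pole ι hdense x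
      have : c ∈ ((pval ι x).valuationSubring : Set k) := by rw [h]; trivial
      exact absurd hc (not_lt.2 this))
    obtain ⟨b, hb1, hb2⟩ : ∃ b, pval ι y b ≤ 1 ∧ 1 < pval ι x b := by
      by_contra! hsub'
      refine hxy ((huniq x ?_).trans (huniq y ?_).symm)
      · intro a
        rw [← pval_le_one_iff', Valuation.mem_valuationSubring_iff]
      · intro a
        rw [← pval_le_one_iff', Valuation.mem_valuationSubring_iff]
        exact ⟨hsub a, hsub' a⟩
    obtain ⟨c, hc⟩ := exists_pole ι hdense y
    obtain ⟨n, hn⟩ := MulArchimedean.arch (pval ι x c) hb2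
    have hb0 : b ≠ 0 := by rintro rfl; simp at hb2
    refine absurd (hsub (c / b ^ n) ?_) (not_le.2 ?_)
    · rw [map_div₀, map_pow, div_le_one₀ (pow_pos (zero_lt_one.trans hb2) n)]
      exact hn
    · rw [map_div₀, map_pow, one_lt_div₀ (pow_pos ((Valuation.pos_iff _).2 hb0) n)]
      exact (pow_le_one' hb1 n).trans_lt hc
  · intro x c hc0
    refine le_antisymm (hc x c) ?_
    have h1 := hc x c⁻¹
    rw [map_inv₀, map_inv₀] at h1
    exact (inv_le_one₀ (by
      rw [Valuation.pos_iff]; simpa using hc0)).1 h1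
  · intro x a ha
    obtain ⟨g, hg⟩ := (pval_le_one_iff' ι x a).1 ha
    have hintg : IsIntegral F (PowerSeries.constantCoeff g) := IsIntegral.of_finite F _
    refine ⟨minpoly F (PowerSeries.constantCoeff g), minpoly.irreducible hintg, ?_⟩
    set p := minpoly F (PowerSeries.constantCoeff g) with hp
    have h1 : ι x (aeval a p) =
        HahnSeries.ofPowerSeries ℤ (κ x) (eval₂ (algebraMap F (PowerSeries (κ x))) g p) := by
      rw [Polynomial.hom_eval₂, ← hg, ← aeval_algHom_apply]
      rfl
    have h2 : PowerSeries.constantCoeff (eval₂ (algebraMap F (PowerSeries (κ x))) g p) = 0 := by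
      rw [Polynomial.hom_eval₂]
      have : (PowerSeries.constantCoeff (R := κ x)).comp (algebraMap F (PowerSeries (κ x))) =
          algebraMap F (κ x) := by
        ext c
        simp [PowerSeries.algebraMap_apply]
      rw [this]
      exact minpoly.aeval F _
    apply pval_lt_one
    intro n hn
    rcases lt_or_eq_of_le (show n ≤ 0 by omega) with h | rfl
    · exact (pval_le_one_iff ι x _).1 ((pval_le_one_iff' ι x _).2 ⟨_, h1⟩) n h
    · rw [h1]
      have := HahnSeries.ofPowerSeries_apply_coeff (Γ := ℤ)
        (eval₂ (algebraMap F (PowerSeries (κ x))) g p) 0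
      rw [Nat.cast_zero] at this
      rw [this, PowerSeries.coeff_zero_eq_constantCoeff_apply, h2]

lemma regular_const
    (hgc : ∀ a : k, IsAlgebraic F a → a ∈ (algebraMap F k).range)
    (hplaces : ∀ O : ValuationSubring k,
      (∀ c : F, algebraMap F k c ∈ O) → (O : Set k) ≠ Set.univ →
      ∃! x : I, ∀ a : k,
        a ∈ O ↔ ∃ g : PowerSeries (κ x), (ι x) a = HahnSeries.ofPowerSeries ℤ (κ x) g)
    (a : k) (ha : ∀ x, pval ι x a ≤ 1) : a ∈ (algebraMap F k).range := by
  apply hgc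
  have h := iInf_valuationSubring_superset (K := k) (s := Set.range (algebraMap F k))
  have h2 : a ∈ (⨅ V : {V : ValuationSubring k // Set.range (algebraMap F k) ⊆ V.toSubring},
      V.1.toSubring) := by
    rw [Subring.mem_iInf]
    rintro ⟨O, hO⟩
    by_cases hu : (O : Set k) = Set.univ
    · have : a ∈ (O : Set k) := by rw [hu]; trivial
      exact this
    · obtain ⟨x, hx, -⟩ := hplaces O (fun c => hO ⟨c, rfl⟩) hu
      exact (hx a).2 ((pval_le_one_iff' ι x a).1 (ha x))
  rw [h] at h2
  have h3 : IsIntegral (Subring.closure (Set.range (algebraMap F k))) a := h2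
  have h4 : IsIntegral F a := by
    obtain ⟨p, hp, hpa⟩ := h3
    have hcl : Subring.closure (Set.range (algebraMap F k)) = (algebraMap F k).range := by
      rw [← RingHom.coe_range, Subring.closure_eq]
    set q := p.map (algebraMap (Subring.closure (Set.range (algebraMap F k))) k) with hq
    have hl : q ∈ Polynomial.lifts (algebraMap F k) := by
      rw [Polynomial.lifts_iff_coeff_lifts]
      intro n
      rw [hq, coeff_map]
      have h5 : ((p.coeff n : Subring.closure (Set.range (algebraMap F k))) : k) ∈
        Subring.closure (Set.range (algebraMap F k)) := (p.coeff n).2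
      exact hcl.le h5
    obtain ⟨r, hr, -, hrm⟩ := Polynomial.lifts_and_natDegree_eq_and_monic hl (hp.map _)
    refine ⟨r, hrm, ?_⟩
    rw [← eval_map, hr, hq, eval_map, hpa]
  exact h4.isAlgebraic

end PL

end ResThm


namespace ResThm

section Glob

open Polynomial IntermediateField

variable {F k : Type} [Field F] [Field k] [Algebra F k] {I : Type}
  {κ : I → Type} [∀ x, Field (κ x)] [∀ x, Algebra F (κ x)] (ι : ∀ x, k →ₐ[F] LaurentSeries (κ x))

noncomputable instance gNeg : AddCommGroup (Π₀ x, Neg F (κ x)) :=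
  @DFinsupp.addCommGroup I (fun x => Neg F (κ x)) (fun _ => inferInstance)

lemma pp_ι_eq_zero (x : I) (a : k) : pp F (κ x) (ι x a) = 0 ↔ pval ι x a ≤ 1 := by
  rw [pp_eq_zero_iff, pval_le_one_iff]

open Classical in
/-- principal parts map -/
noncomputable def phi (H : Places F (pval ι)) : k →ₗ[F] Π₀ x, Neg F (κ x) where
  toFun a := DFinsupp.mk (H.finite_poles a).toFinset (fun x => pp F (κ x) (ι x a))
  map_add' a b := by
    ext1 x
    have h : ∀ a, (DFinsupp.mk (H.finite_poles a).toFinset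
        (fun x => pp F (κ x) (ι x a)) : Π₀ x, Neg F (κ x)) x = pp F (κ x) (ι x a) := by
      intro a
      rw [DFinsupp.mk_apply]
      split_ifs with h
      · rfl
      · exact ((pp_ι_eq_zero ι x a).2 (by simpa using h)).symm
    rw [DFinsupp.add_apply, h, h, h, map_add, map_add]
  map_smul' c a := by
    ext1 x
    have h : ∀ a, (DFinsupp.mk (H.finite_poles a).toFinset
        (fun x => pp F (κ x) (ι x a)) : Π₀ x, Neg F (κ x)) x = pp F (κ x) (ι x a) := by
      intro a
      rw [DFinsupp.mk_apply]
      split_ifs with h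
      · rfl
      · exact ((pp_ι_eq_zero ι x a).2 (by simpa using h)).symm
    rw [RingHom.id_apply, DFinsupp.smul_apply, h, h, ι_smul, ← smul_eq_C_mul F c, LinearMap.map_smul]

lemma phi_apply (H : Places F (pval ι)) (a : k) (x : I) :
    phi ι H a x = pp F (κ x) (ι x a) := by
  classical
  change (DFinsupp.mk (H.finite_poles a).toFinset
        (fun x => pp F (κ x) (ι x a)) : Π₀ x, Neg F (κ x)) x = pp F (κ x) (ι x a)
  rw [DFinsupp.mk_apply]
  split_ifs with h
  · rfl
  · exact ((pp_ι_eq_zero ι x a).2 (by simpa using h)).symm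

lemma phi_apply_eq (H : Places F (pval ι)) (a b : k) (x : I) (h : pval ι x (a - b) ≤ 1) :
    phi ι H a x = phi ι H b x := by
  rw [← sub_eq_zero, ← DFinsupp.sub_apply, ← map_sub, phi_apply, pp_ι_eq_zero]
  exact h

lemma phi_apply_zero (H : Places F (pval ι)) (a : k) (x : I) (h : pval ι x a ≤ 1) :
    phi ι H a x = 0 := by
  rw [phi_apply, pp_ι_eq_zero]
  exact h

lemma phi_ker (H : Places F (pval ι))
    (hreg : ∀ a : k, (∀ x, pval ι x a ≤ 1) → a ∈ (algebraMap F k).range) :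
    FiniteDimensional F (LinearMap.ker (phi ι H)) := by
  have : LinearMap.ker (phi ι H) ≤ Submodule.span F {(1 : k)} := by
    intro a ha
    obtain ⟨c, rfl⟩ := hreg a (fun x => by
      rw [← pp_ι_eq_zero, ← phi_apply ι H, LinearMap.mem_ker.1 ha]; rfl)
    rw [Algebra.algebraMap_eq_smul_one]
    exact Submodule.smul_mem _ _ (Submodule.subset_span rfl)
  have hfd : FiniteDimensional F (Submodule.span F {(1 : k)}) := inferInstance
  exact Submodule.finiteDimensional_of_le this

lemma phi_coker (H : Places F (pval ι)) (t : k) (ht : ¬ IsAlgebraic F t)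
    (hdense : ∀ (x : I) (f : LaurentSeries (κ x)) (N : ℤ),
      ∃ a : k, ∀ m ≤ N, ((ι x) a - f).coeff m = 0) :
    ∃ X : Submodule F (Π₀ x, Neg F (κ x)), FiniteDimensional F X ∧
      LinearMap.range (phi ι H) ⊔ X = ⊤ := by
  classical
  obtain ⟨U, hU, hsplit⟩ := H.split t ht
  set θ := (DFinsupp.filterLinearMap F (fun x => Neg F (κ x)) (fun x => 1 < pval ι x t)) ∘ₗ
    phi ι H with hθ
  have hθa : ∀ a x, θ a x = if 1 < pval ι x t then phi ι H a x else 0 := by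
    intro a x
    rw [hθ, LinearMap.comp_apply, DFinsupp.filterLinearMap_apply, DFinsupp.filter_apply]
  refine ⟨U.map θ, inferInstance, ?_⟩
  rw [eq_top_iff]
  intro h _
  choose b hb using fun x => hdense x (h x : LaurentSeries (κ x)) (-1)
  have hb' : ∀ x, phi ι H (b x) x = h x := by
    intro x
    rw [phi_apply, ← pp_coe F (κ x) (h x), ← sub_eq_zero, ← map_sub, pp_eq_zero_iff]
    intro n hn
    exact hb x n (by omega)
  obtain ⟨a, ha⟩ := H.strong t ht h.support b
  have ha' : ∀ x, pval ι x t ≤ 1 → phi ι H a x = h x := by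
    intro x hx
    by_cases hxs : x ∈ h.support
    · rw [← hb']
      exact phi_apply_eq ι H _ _ x ((ha x hx).1 hxs)
    · rw [phi_apply_zero ι H a x ((ha x hx).2 hxs)]
      exact (by simpa using hxs : h x = 0).symm
  obtain ⟨c, hc⟩ := weak_approx (pval ι) H.sep (H.finite_poles t).toFinset (fun x => b x - a)
  have hc' : ∀ x, 1 < pval ι x t → phi ι H c x = h x - phi ι H a x := by
    intro x hx
    rw [phi_apply_eq ι H c (b x - a) x (hc x (by simpa using hx)), map_sub, DFinsupp.sub_apply, hb']
  have hh : h = phi ι H a + θ c := by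
    ext1 x
    rw [DFinsupp.add_apply, hθa]
    split_ifs with hx
    · rw [hc' x hx]; abel
    · rw [ha' x (not_lt.1 hx), add_zero]
  obtain ⟨a1, a2, a3, h3, rfl, h1, h2⟩ := hsplit c
  have e1 : θ a1 = phi ι H a1 := by
    ext1 x
    rw [hθa]
    split_ifs with hx
    · rfl
    · exact (phi_apply_zero ι H a1 x (h1 x (not_lt.1 hx))).symm
  have e2 : θ a2 = 0 := by
    ext1 x
    rw [hθa]
    split_ifs with hx
    · exact phi_apply_zero ι H a2 x (h2 x hx)
    · rfl
  rw [hh, map_add, map_add, e1, e2, add_zero, ← add_assoc, ← map_add]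
  exact Submodule.add_mem_sup ⟨_, rfl⟩ (Submodule.mem_map_of_mem h3)

/-- compressed multiplication on global principal parts -/
noncomputable def SS (f : k) : (Π₀ x, Neg F (κ x)) →ₗ[F] Π₀ x, Neg F (κ x) :=
  DFinsupp.mapRange.linearMap (fun x => cmul F (ι x f))

lemma SS_apply (f : k) (h : Π₀ x, Neg F (κ x)) (x : I) :
    SS ι f h x = cmul F (ι x f) (h x) := by
  rw [SS, DFinsupp.mapRange.linearMap_apply, DFinsupp.mapRange_apply]

lemma decomp [DecidableEq I] {V : Type} [AddCommGroup V] [Module F V] (T : Finset I)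
    (A : V →ₗ[F] Π₀ x, Neg F (κ x)) (hA : ∀ v, ∀ x ∉ T, A v x = 0) :
    A = ∑ x ∈ T, DFinsupp.lsingle x ∘ₗ (DFinsupp.lapply x ∘ₗ A) := by
  apply LinearMap.ext
  intro v
  ext1 y
  rw [LinearMap.sum_apply, DFinsupp.finsetSum_apply]
  have : ∀ x, (DFinsupp.lsingle x ∘ₗ (DFinsupp.lapply (R := F) x ∘ₗ A)) v y =
      if y = x then A v y else 0 := by
    intro x
    simp only [LinearMap.comp_apply, DFinsupp.lsingle_apply, DFinsupp.lapply_apply]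
    split_ifs with h
    · subst h
      simp
    · rw [DFinsupp.single_eq_of_ne h]
  simp only [this]
  rw [Finset.sum_ite_eq]
  split_ifs with h
  · rfl
  · exact hA v y h

lemma FR_decomp {V : Type} [AddCommGroup V] [Module F V] (T : Finset I)
    (A : V →ₗ[F] Π₀ x, Neg F (κ x)) (hA : ∀ v, ∀ x ∉ T, A v x = 0)
    (hF : ∀ x ∈ T, FR (DFinsupp.lapply (R := F) x ∘ₗ A)) : FR A := by
  classical
  rw [decomp T A hA]
  exact FR.sum _ _ fun x hx => (hF x hx).comp_left _

lemma hank_regular (x : I) (f : k) (hf : pval ι x f ≤ 1) : hank F (ι x f) = 0 := by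
  rw [hank_eq F (ι x f) 0 (by simpa using (pval_le_one_iff ι x f).1 hf)]
  simp

lemma FR_SS [∀ x, FiniteDimensional F (κ x)] (H : Places F (pval ι)) (f : k) :
    FR (SS ι f ∘ₗ phi ι H - phi ι H ∘ₗ LinearMap.mulLeft F f) := by
  have key : ∀ a x, (SS ι f ∘ₗ phi ι H - phi ι H ∘ₗ LinearMap.mulLeft F f) a x =
      - hank F (ι x f) (ι x a) := by
    intro a x
    rw [LinearMap.sub_apply, DFinsupp.sub_apply, LinearMap.comp_apply, LinearMap.comp_apply,
      SS_apply, phi_apply, phi_apply, LinearMap.mulLeft_apply, map_mul, cmul_apply, hank_apply,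
      mul_sub, map_sub]
    abel
  refine FR_decomp (H.finite_poles f).toFinset _ ?_ ?_
  · intro a x hx
    rw [key, hank_regular ι x f (by simpa using hx)]
    simp
  · intro x _
    obtain ⟨X, hX, hXm⟩ := FR_hank F (ι x f)
    refine ⟨X, hX, fun a => ?_⟩
    rw [LinearMap.comp_apply, DFinsupp.lapply_apply, key]
    exact X.neg_mem (hXm _)

theorem res_main (H : Places F (pval ι)) [∀ x, FiniteDimensional F (κ x)]
    (hker : FiniteDimensional F (LinearMap.ker (phi ι H)))
    (hcok : ∃ X : Submodule F (Π₀ x, Neg F (κ x)), FiniteDimensional F X ∧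
      LinearMap.range (phi ι H) ⊔ X = ⊤) (f g : k) :
    {x : I | (ι x f * lseriesDeriv (ι x g)).coeff (-1) ≠ 0}.Finite ∧
    ∑ᶠ x, Algebra.trace F (κ x) ((ι x f * lseriesDeriv (ι x g)).coeff (-1)) = 0 := by
  classical
  obtain ⟨-, h0⟩ := ftr_commutator_eq_zero (phi ι H) hker hcok (LinearMap.mulLeft F f)
    (LinearMap.mulLeft F g) (by ext a; simp [mul_left_comm]) (SS ι f) (SS ι g)
    (FR_SS ι H f) (FR_SS ι H g)
  set T := (H.finite_poles f).toFinset ∪ (H.finite_poles g).toFinset with hT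
  have hTf : ∀ x ∉ T, pval ι x f ≤ 1 := by
    intro x hx
    simp only [hT, Finset.mem_union, not_or] at hx
    simpa using hx.1
  have hTg : ∀ x ∉ T, pval ι x g ≤ 1 := by
    intro x hx
    simp only [hT, Finset.mem_union, not_or] at hx
    simpa using hx.2
  have hres : ∀ x ∉ T, (ι x f * lseriesDeriv (ι x g)).coeff (-1) = 0 := by
    intro x hx
    rw [residue_eq (ι x f) (ι x g) 0 (by simpa using (pval_le_one_iff ι x f).1 (hTf x hx))
      (by simpa using (pval_le_one_iff ι x g).1 (hTg x hx))]
    simp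
  have hcomp : ∀ x, DFinsupp.lapply (R := F) x ∘ₗ (SS ι f ∘ₗ SS ι g - SS ι g ∘ₗ SS ι f) =
      (cmul F (ι x f) ∘ₗ cmul F (ι x g) - cmul F (ι x g) ∘ₗ cmul F (ι x f)) ∘ₗ
        DFinsupp.lapply x := by
    intro x
    apply LinearMap.ext
    intro h
    simp only [LinearMap.comp_apply, LinearMap.sub_apply, DFinsupp.lapply_apply, SS_apply,
      DFinsupp.sub_apply]
  have hdec := decomp T (SS ι f ∘ₗ SS ι g - SS ι g ∘ₗ SS ι f) (by
    intro h x hx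
    have := LinearMap.congr_fun (hcomp x) h
    rw [cmul_comm_eq, hank_regular ι x f (hTf x hx), hank_regular ι x g (hTg x hx)] at this
    simpa using this)
  refine ⟨T.finite_toSet.subset fun x hx => ?_, ?_⟩
  · by_contra h
    exact hx (hres x h)
  rw [finsum_eq_sum_of_support_subset (s := T) _ (by
    intro x hx
    by_contra h
    refine hx ?_
    simp only [hres x h, map_zero])]
  rw [hdec, ftr_sum] at h0
  · rw [← neg_eq_zero, ← Finset.sum_neg_distrib, ← h0]
    refine Finset.sum_congr rfl fun x _ => ?_
    rw [hcomp, ← ftr_comm _ _ ((ftr_local F (ι x f) (ι x g)).1.comp_right _),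
      ← (ftr_local F (ι x f) (ι x g)).2, LinearMap.comp_assoc]
    congr 1
    apply LinearMap.ext
    intro h
    simp
  · intro x _
    rw [hcomp]
    exact ((ftr_local F (ι x f) (ι x g)).1.comp_right _).comp_left _

end Glob

end ResThm


/-!
STATEMENT 15: Let `Y` be a smooth projective geometrically connected curve over a perfect
field `F` with function field `k`.  For every rational differential `ω ∈ Ω¹_{k/F}` the sum
`∑ₓ Tr_{κ(x)/F} (Res_x ω)` over all closed points `x` of `Y` vanishes.

Modeling: the curve is encoded by its function field `k` (a finitely generated extension of
`F` of transcendence degree `1` in which `F` is algebraically closed, i.e. geometrically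
connected) together with the family of its closed points (= places): an index type `I`, for
each `x : I` a finite extension `κ x` of `F` (the residue field) and the `F`-embedding
`ι x : k → κ(x)((t))` into the completed local field, which has dense image; every nontrivial
`F`-valuation subring of `k` arises from exactly one `x` (so `I` is exactly the set of closed
points of the smooth projective model).  The residue map `Res x` is characterized by
`Res x (f • dg) = coeff₋₁ (ι x f · (ι x g)')`.  The conclusion states that `x ↦ Res x ω` has
finite support and that the sum of the traces of the residues vanishes.
-/
theorem statement_15
    (F : Type) [Field F] [PerfectField F]
    (k : Type) [Field k] [Algebra F k]
    (hfg : ∃ t : k, ¬ IsAlgebraic F t ∧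
      FiniteDimensional (IntermediateField.adjoin F ({t} : Set k)) k)
    (hgc : ∀ a : k, IsAlgebraic F a → a ∈ (algebraMap F k).range)
    (I : Type)
    (κ : I → Type) [∀ x, Field (κ x)] [∀ x, Algebra F (κ x)]
    [∀ x, FiniteDimensional F (κ x)]
    (ι : ∀ x, k →ₐ[F] LaurentSeries (κ x))
    (hdense : ∀ (x : I) (f : LaurentSeries (κ x)) (N : ℤ),
      ∃ a : k, ∀ m ≤ N, ((ι x) a - f).coeff m = 0)
    (hplaces : ∀ O : ValuationSubring k,
      (∀ c : F, algebraMap F k c ∈ O) → (O : Set k) ≠ Set.univ →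
      ∃! x : I, ∀ a : k,
        a ∈ O ↔ ∃ g : PowerSeries (κ x), (ι x) a = HahnSeries.ofPowerSeries ℤ (κ x) g)
    (Res : ∀ x : I, Ω[k⁄F] →ₗ[F] κ x)
    (hRes : ∀ (x : I) (f g : k),
      Res x (f • KaehlerDifferential.D F k g)
        = ((ι x) f * lseriesDeriv ((ι x) g)).coeff (-1)) :
    ∀ ω : Ω[k⁄F],
      {x : I | Res x ω ≠ 0}.Finite ∧
      ∑ᶠ x : I, Algebra.trace F (κ x) (Res x ω) = 0 := by
  obtain ⟨t, ht, hfd⟩ := hfg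
  have H := ResThm.places ι ⟨t, ht, hfd⟩ hgc hdense hplaces
  have hker := ResThm.phi_ker ι H (ResThm.regular_const ι hgc hplaces)
  have hcok := ResThm.phi_coker ι H t ht hdense
  have key : ∀ ω : Ω[k⁄F], ∀ c : k, {x : I | Res x (c • ω) ≠ 0}.Finite ∧
      ∑ᶠ x : I, Algebra.trace F (κ x) (Res x (c • ω)) = 0 := by
    intro ω
    have hω : ω ∈ Submodule.span k (Set.range (KaehlerDifferential.D F k)) := by
      rw [KaehlerDifferential.span_range_derivation]
      trivial
    induction hω using Submodule.span_induction with
    | mem ω h =>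
      obtain ⟨g, rfl⟩ := h
      intro c
      simp only [hRes]
      exact ResThm.res_main ι H hker hcok c g
    | zero => intro c; simp
    | add a b _ _ ha hb =>
      intro c
      have hsub : {x : I | Res x (c • (a + b)) ≠ 0} ⊆
          {x : I | Res x (c • a) ≠ 0} ∪ {x : I | Res x (c • b) ≠ 0} := by
        intro x hx
        by_contra h
        simp only [Set.mem_union, Set.mem_setOf_eq, not_or, not_not] at h
        exact hx (by rw [smul_add, map_add, h.1, h.2, add_zero])
      have hsupp : ∀ d : Ω[k⁄F], Function.support (fun x => Algebra.trace F (κ x) (Res x d)) ⊆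
          {x : I | Res x d ≠ 0} := by
        intro d x hx h
        exact hx (by simp only [h, map_zero])
      refine ⟨((ha c).1.union (hb c).1).subset hsub, ?_⟩
      simp only [smul_add, map_add]
      rw [finsum_add_distrib ((ha c).1.subset (hsupp _)) ((hb c).1.subset (hsupp _)),
        (ha c).2, (hb c).2, add_zero]
    | smul r a _ ha =>
      intro c
      rw [smul_smul]
      exact ha _
  intro ω
  simpa only [one_smul] using key ω 1
end
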